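/- arXiv:2512.02151 — 4 statements merged into one kernel-verified Lean document; each statement's English description precedes it below -/
import Mathlib

section
/- For real numbers a, b, the following are equivalent: (i) there exists a continuous increasing function g : [0,1] → ℝ that is not constant, with g(0) = 0, g(1) = b, and I(g)(1) = a; (ii) 0 < a < b. (This characterizes the set W₁ of possible pairs (D⁰f(1), D¹f(1)) for C¹ functions f on [0,1] with Df increasing and nonconstant and f(0) = Df(0) = 0, via g = Df.) -/
open Set

/-- The integral operator `I(g)(x) = ∫₀ˣ g(t) dt`. -/
noncomputable def I (g : ℝ → ℝ) : ℝ → ℝ := fun x => ∫ t in (0:ℝ)..x, g t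

theorem stmt3 (a b : ℝ) :
    (∃ g : ℝ → ℝ, ContinuousOn g (Icc 0 1) ∧ MonotoneOn g (Icc 0 1) ∧
      (∃ x ∈ Icc (0:ℝ) 1, ∃ y ∈ Icc (0:ℝ) 1, g x ≠ g y) ∧
      g 0 = 0 ∧ g 1 = b ∧ I g 1 = a) ↔
    (0 < a ∧ a < b) := by
  have h0 : (0:ℝ) ∈ Icc (0:ℝ) 1 := by simp
  have h1 : (1:ℝ) ∈ Icc (0:ℝ) 1 := by simp
  constructor
  · rintro ⟨g, hc, hm, ⟨x, hx, y, hy, hxy⟩, hg0, hg1, rfl⟩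
    have hnonneg : ∀ t ∈ Icc (0:ℝ) 1, 0 ≤ g t := fun t ht => hg0 ▸ hm h0 ht ht.1
    have hle : ∀ t ∈ Icc (0:ℝ) 1, g t ≤ b := fun t ht => hg1 ▸ hm ht h1 ht.2
    have hb : 0 < b := by
      by_contra! hb
      exact hxy (by linarith [hnonneg x hx, hnonneg y hy, hle x hx, hle y hy])
    constructor
    · have h := intervalIntegral.integral_lt_integral_of_continuousOn_of_le_of_exists_lt
        zero_lt_one continuousOn_const hc (fun t ht => hnonneg t (Ioc_subset_Icc_self ht))
        ⟨1, h1, by rwa [hg1]⟩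
      simpa [I] using h
    · have h := intervalIntegral.integral_lt_integral_of_continuousOn_of_le_of_exists_lt
        zero_lt_one hc continuousOn_const (fun t ht => hle t (Ioc_subset_Icc_self ht))
        ⟨0, h0, by rwa [hg0]⟩
      simpa [I] using h
  · rintro ⟨ha, hab⟩
    have hb : 0 < b := ha.trans hab
    have hp : 0 < b / a - 1 := sub_pos.2 ((one_lt_div ha).2 hab)
    refine ⟨fun x => b * x ^ (b / a - 1), ?_, ?_, ⟨0, h0, 1, h1, ?_⟩, ?_, ?_, ?_⟩
    · exact (continuous_const.mul (Real.continuous_rpow_const hp.le)).continuousOn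
    · intro x hx y _ hxy
      exact mul_le_mul_of_nonneg_left (Real.rpow_le_rpow hx.1 hxy hp.le) hb.le
    · simpa [Real.zero_rpow hp.ne'] using hb.ne
    · simp [Real.zero_rpow hp.ne']
    · simp
    · have hne : b / a ≠ 0 := (div_pos hb ha).ne'
      simp only [I, intervalIntegral.integral_const_mul]
      rw [integral_rpow (Or.inl (by linarith)), sub_add_cancel, Real.one_rpow,
        Real.zero_rpow hne]
      field_simp
      simp
end

section
/- For real numbers a, b, c, the following are equivalent: (i) there exists a continuous increasing function g : [0,1] → ℝ that is not constant, with g(0) = 0, g(1) = c, I(g)(1) = b, and I²(g)(1) = a; (ii) 0 < 2a < b and b² < 2ac. (This characterizes the set W₂ of possible triples (D⁰f(1), D¹f(1), D²f(1)) for C² functions f on [0,1] with D²f increasing and nonconstant and D^jf(0) = 0 for j = 0,1,2, via g = D²f.) -/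
open Set

theorem hasDerivAt_I {g : ℝ → ℝ} (hg : Continuous g) (x : ℝ) : HasDerivAt (I g) (g x) x :=
  intervalIntegral.integral_hasDerivAt_right (hg.intervalIntegrable _ _)
    (hg.stronglyMeasurableAtFilter _ _) hg.continuousAt

theorem continuous_I {g : ℝ → ℝ} (hg : Continuous g) : Continuous (I g) :=
  continuous_iff_continuousAt.2 fun x => (hasDerivAt_I hg x).continuousAt

theorem I_zero (g : ℝ → ℝ) : I g 0 = 0 := by simp [I]

theorem I_congr {f g : ℝ → ℝ} (h : EqOn f g (Icc 0 1)) : EqOn (I f) (I g) (Icc 0 1) := by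
  intro x hx
  refine intervalIntegral.integral_congr fun t ht => h ?_
  rw [uIcc_of_le hx.1] at ht
  exact ⟨ht.1, ht.2.trans hx.2⟩

theorem I_linear_comb {f g : ℝ → ℝ} (hf : Continuous f) (hg : Continuous g) (p q : ℝ) :
    I (fun x => p * f x + q * g x) = fun x => p * I f x + q * I g x := by
  funext x
  simp only [I]
  rw [intervalIntegral.integral_add ((hf.const_mul p).intervalIntegrable _ _)
    ((hg.const_mul q).intervalIntegrable _ _), intervalIntegral.integral_const_mul,
    intervalIntegral.integral_const_mul]

theorem hasDerivAt_max_sub_pow (α : ℝ) (k : ℕ) {x : ℝ} (hx : x ≠ α) :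
    HasDerivAt (fun t : ℝ => max 0 (t - α) ^ (k + 2) / (k + 2)) (max 0 (x - α) ^ (k + 1)) x := by
  have hk : (k : ℝ) + 2 ≠ 0 := by positivity
  rcases lt_or_gt_of_ne hx with h | h
  · rw [max_eq_left (by linarith), zero_pow (by omega)]
    refine (hasDerivAt_const x (0 : ℝ)).congr_of_eventuallyEq ?_
    filter_upwards [Iio_mem_nhds h] with t ht
    rw [max_eq_left (by linarith [mem_Iio.1 ht]), zero_pow (by omega), zero_div]
  · rw [max_eq_right (by linarith)]
    have h1 := (((hasDerivAt_id x).sub_const α).pow (k + 2)).div_const ((k : ℝ) + 2)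
    refine (h1.congr_deriv ?_).congr_of_eventuallyEq ?_
    · simp
      field_simp
    · filter_upwards [Ioi_mem_nhds h] with t ht
      rw [max_eq_right (by linarith [mem_Ioi.1 ht])]
      simp

theorem I_max_sub_pow {α : ℝ} (hα : 0 ≤ α) (k : ℕ) :
    I (fun t => max 0 (t - α) ^ (k + 1)) = fun x => max 0 (x - α) ^ (k + 2) / (k + 2) := by
  funext x
  have hc : Continuous fun t : ℝ => max 0 (t - α) ^ (k + 1) := by fun_prop
  have h := MeasureTheory.integral_eq_of_hasDerivAt_off_countable
    (fun t : ℝ => max 0 (t - α) ^ (k + 2) / (k + 2)) (fun t => max 0 (t - α) ^ (k + 1))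
    (a := 0) (b := x) (countable_singleton α) (by fun_prop)
    (fun t ht => hasDerivAt_max_sub_pow α k (by simpa using ht.2)) (hc.intervalIntegrable _ _)
  rw [I, h, max_eq_left (by linarith : 0 - α ≤ 0)]
  simp

/-- A ramp rising linearly from `0` to `1` over `[1 - x - w, 1 - x + w]`. -/
theorem exists_ramp {x w : ℝ} (hw : 0 < w) (hwx : w ≤ x) (hxw : x ≤ 1 - w) :
    ∃ g : ℝ → ℝ, Continuous g ∧ Monotone g ∧ g 0 = 0 ∧ g 1 = 1 ∧ I g 1 = x ∧
      I (I g) 1 = x ^ 2 / 2 + w ^ 2 / 6 := by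
  have hinge (α : ℝ) (hα : 0 ≤ α) :
      I (fun t => max 0 (t - α)) = fun t => 1 / 2 * max 0 (t - α) ^ 2 := by
    have := I_max_sub_pow hα 0
    simp only [zero_add, pow_one] at this
    rw [this]
    funext t
    norm_num
    ring
  have hinge_sq (α : ℝ) (hα : 0 ≤ α) :
      I (fun t => max 0 (t - α) ^ 2) = fun t => max 0 (t - α) ^ 3 / 3 := by
    have := I_max_sub_pow hα 1
    norm_num at this
    exact this
  have h1 : 0 ≤ 1 - x - w := by linarith
  have h2 : 0 ≤ 1 - x + w := by linarith
  have hc (α : ℝ) : Continuous fun t : ℝ => max 0 (t - α) := by fun_prop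
  have hc2 (α : ℝ) : Continuous fun t : ℝ => max 0 (t - α) ^ 2 := by fun_prop
  have hI : I (fun t => 1 / (2 * w) * max 0 (t - (1 - x - w))
      + -(1 / (2 * w)) * max 0 (t - (1 - x + w))) =
      fun t => 1 / (4 * w) * max 0 (t - (1 - x - w)) ^ 2
        + -(1 / (4 * w)) * max 0 (t - (1 - x + w)) ^ 2 := by
    rw [I_linear_comb (hc _) (hc _), hinge _ h1, hinge _ h2]
    funext t
    field_simp
    ring
  have e1 : max 0 (1 - (1 - x - w)) = x + w := by
    rw [max_eq_right] <;> linarith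
  have e2 : max 0 (1 - (1 - x + w)) = x - w := by
    rw [max_eq_right] <;> linarith
  refine ⟨fun t => 1 / (2 * w) * max 0 (t - (1 - x - w))
    + -(1 / (2 * w)) * max 0 (t - (1 - x + w)), by fun_prop, ?_, ?_, ?_, ?_, ?_⟩
  · intro s t hst
    have key : max 0 (s - (1 - x - w)) - max 0 (s - (1 - x + w)) ≤
        max 0 (t - (1 - x - w)) - max 0 (t - (1 - x + w)) := by grind
    have := mul_le_mul_of_nonneg_left key (by positivity : 0 ≤ 1 / (2 * w))
    simp only
    linarith
  · simp only
    rw [max_eq_left (by linarith), max_eq_left (by linarith)]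
    ring
  · simp only [e1, e2]
    field_simp
    ring
  · rw [hI]
    simp only [e1, e2]
    field_simp
    ring
  · rw [hI, I_linear_comb (hc2 _) (hc2 _), hinge_sq _ h1, hinge_sq _ h2]
    simp only [e1, e2]
    field_simp
    ring

theorem exists_of_moments {m s : ℝ} (h1 : m ^ 2 < s) (h2 : s < m) :
    ∃ g : ℝ → ℝ, Continuous g ∧ Monotone g ∧ g 0 = 0 ∧ g 1 = 1 ∧ I g 1 = m ∧
      I (I g) 1 = s / 2 := by
  obtain ⟨w, hw, hw1, hw2⟩ : ∃ w : ℝ, 0 < w ∧ w ≤ m - s ∧ w ≤ s - m ^ 2 :=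
    ⟨min (m - s) (s - m ^ 2), lt_min (by linarith) (by linarith), min_le_left _ _,
      min_le_right _ _⟩
  have hs : 0 < s := by nlinarith
  have hm1 : m < 1 := by nlinarith
  have hmw : 0 < m - w := by linarith
  set V := s - m ^ 2 - w ^ 2 / 3 with hV
  have hVpos : 0 < V := by nlinarith
  obtain ⟨y, hy⟩ : ∃ y, y = m + V / (m - w) := ⟨_, rfl⟩
  have hym : m < y := by
    have : 0 < V / (m - w) := by positivity
    linarith
  have hyV : (y - m) * (m - w) = V := by
    rw [hy]
    field_simp
    ring
  have hy1 : y ≤ 1 - w := by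
    have : V / (m - w) ≤ 1 - w - m := by
      rw [div_le_iff₀ hmw]
      nlinarith
    linarith
  obtain ⟨f, fc, fm, f0, f1, fI, fII⟩ := exists_ramp hw (by linarith : w ≤ y) hy1
  obtain ⟨g, gc, gm, g0, g1, gI, gII⟩ := exists_ramp hw le_rfl (by linarith : w ≤ 1 - w)
  have hyw : 0 < y - w := by linarith
  have hp : 0 ≤ (m - w) / (y - w) := by positivity
  have hq : 0 ≤ (y - m) / (y - w) := div_nonneg (by linarith) hyw.le
  refine ⟨fun t => (m - w) / (y - w) * f t + (y - m) / (y - w) * g t, by fun_prop, ?_, ?_, ?_,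
    ?_, ?_⟩
  · exact (fm.const_mul hp).add (gm.const_mul hq)
  · simp [f0, g0]
  · simp only [f1, g1]
    field_simp
    ring
  · rw [I_linear_comb fc gc]
    simp only [fI, gI]
    field_simp
    ring
  · rw [I_linear_comb fc gc, I_linear_comb (continuous_I fc) (continuous_I gc)]
    simp only [fII, gII]
    have hs' : s = m ^ 2 + w ^ 2 / 3 + (y - m) * (m - w) := by linarith
    rw [hs']
    field_simp
    ring

theorem I_pos_and_lt {g : ℝ → ℝ} (hg : Continuous g) (hm : Monotone g) (g0 : g 0 = 0) {t : ℝ}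
    (ht : 0 < t) (hgt : 0 < g t) : 0 < I g t ∧ I g t < t * g t := by
  constructor
  · refine intervalIntegral.integral_pos ht hg.continuousOn
      (fun x hx => g0 ▸ hm hx.1.le) ⟨t, ⟨ht.le, le_rfl⟩, hgt⟩
  · have h : 0 < ∫ x in (0:ℝ)..t, (g t - g x) :=
      intervalIntegral.integral_pos ht (by fun_prop)
        (fun x hx => sub_nonneg.2 (hm hx.2)) ⟨0, ⟨le_rfl, ht.le⟩, by linarith⟩
    rw [intervalIntegral.integral_sub (by simp) (hg.intervalIntegrable _ _)] at h
    simp at h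
    simpa [I] using h

theorem moments_of_monotone {g : ℝ → ℝ} (hg : Continuous g) (hm : Monotone g) (g0 : g 0 = 0)
    (g1 : 0 < g 1) :
    0 < 2 * I (I g) 1 ∧ 2 * I (I g) 1 < I g 1 ∧ I g 1 ^ 2 < 2 * I (I g) 1 * g 1 := by
  have hG := continuous_I hg
  have hGg (t : ℝ) (ht : 0 ≤ t) : 0 ≤ I g t ∧ I g t ≤ t * g t := by
    constructor
    · exact intervalIntegral.integral_nonneg ht fun x hx => g0 ▸ hm hx.1
    · have := intervalIntegral.integral_mono_on (μ := MeasureTheory.volume) ht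
        (hg.intervalIntegrable 0 t)
        ((continuous_const (y := g t)).intervalIntegrable 0 t) fun x hx => hm hx.2
      simpa [I] using this
  obtain ⟨u, hu, hgu⟩ : g 1 / 2 ∈ g '' Icc 0 1 :=
    intermediate_value_Icc zero_le_one hg.continuousOn ⟨by linarith, by linarith⟩
  have hu0 : 0 < u := by
    refine hu.1.lt_of_ne ?_
    rintro rfl
    linarith
  obtain ⟨hIu, hIu'⟩ := I_pos_and_lt hg hm g0 hu0 (by linarith : 0 < g u)
  refine ⟨?_, ?_, ?_⟩
  · have : 0 < I (I g) 1 := intervalIntegral.integral_pos one_pos hG.continuousOn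
      (fun x hx => (hGg x hx.1.le).1) ⟨u, hu, hIu⟩
    linarith
  · have hpos : 0 < ∫ t in (0:ℝ)..1, (t * g t - I g t) :=
      intervalIntegral.integral_pos one_pos (by fun_prop)
        (fun x hx => sub_nonneg.2 (hGg x hx.1.le).2) ⟨u, hu, by linarith⟩
    have hF := intervalIntegral.integral_eq_sub_of_hasDerivAt (a := 0) (b := 1)
      (f := fun t => t * I g t - 2 * I (I g) t) (f' := fun t => t * g t - I g t)
      (fun t _ => (((hasDerivAt_id t).mul (hasDerivAt_I hg t)).sub
        ((hasDerivAt_I hG t).const_mul 2)).congr_deriv (by simp; ring))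
      ((by fun_prop : Continuous fun t => t * g t - I g t).intervalIntegrable _ _)
    rw [hF] at hpos
    simp only [I_zero] at hpos
    linarith
  · have hpos : 0 < ∫ t in (0:ℝ)..1, I g t * (g 1 - g t) :=
      intervalIntegral.integral_pos one_pos (by fun_prop)
        (fun x hx => mul_nonneg (hGg x hx.1.le).1 (sub_nonneg.2 (hm hx.2)))
        ⟨u, hu, mul_pos hIu (by linarith)⟩
    have hF := intervalIntegral.integral_eq_sub_of_hasDerivAt (a := 0) (b := 1)
      (f := fun t => g 1 * I (I g) t - I g t ^ 2 / 2) (f' := fun t => I g t * (g 1 - g t))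
      (fun t _ => (((hasDerivAt_I hG t).const_mul (g 1)).sub
        (((hasDerivAt_I hg t).pow 2).div_const 2)).congr_deriv (by simp; ring))
      ((by fun_prop : Continuous fun t => I g t * (g 1 - g t)).intervalIntegrable _ _)
    rw [hF] at hpos
    simp only [I_zero] at hpos
    linarith

theorem stmt4 (a b c : ℝ) :
    (∃ g : ℝ → ℝ, ContinuousOn g (Icc 0 1) ∧ MonotoneOn g (Icc 0 1) ∧
      (∃ x ∈ Icc (0:ℝ) 1, ∃ y ∈ Icc (0:ℝ) 1, g x ≠ g y) ∧
      g 0 = 0 ∧ g 1 = c ∧ I g 1 = b ∧ I (I g) 1 = a) ↔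
    (0 < 2 * a ∧ 2 * a < b ∧ b ^ 2 < 2 * a * c) := by
  constructor
  · rintro ⟨g, hg, hm, ⟨x, hx, y, hy, hxy⟩, g0, rfl, rfl, rfl⟩
    have h0 : (0:ℝ) ∈ Icc (0:ℝ) 1 := ⟨le_rfl, zero_le_one⟩
    have h1 : (1:ℝ) ∈ Icc (0:ℝ) 1 := ⟨zero_le_one, le_rfl⟩
    have hpos : 0 < g 1 := by
      by_contra! hle
      have hz (z : ℝ) (hz : z ∈ Icc (0:ℝ) 1) : g z = 0 :=
        le_antisymm ((hm hz h1 hz.2).trans hle) (g0 ▸ hm h0 hz hz.1)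
      exact hxy ((hz x hx).trans (hz y hy).symm)
    have hproj (t : ℝ) : max 0 (min 1 t) ∈ Icc (0:ℝ) 1 :=
      ⟨le_max_left _ _, max_le zero_le_one (min_le_left _ _)⟩
    have heq : EqOn (fun t => g (max 0 (min 1 t))) g (Icc 0 1) := by
      intro t ht
      simp only [min_eq_right ht.2, max_eq_right ht.1]
    have key := moments_of_monotone (g := fun t => g (max 0 (min 1 t)))
      (hg.comp_continuous (by fun_prop) hproj)
      (fun s t hst => hm (hproj s) (hproj t) (by gcongr))
      ((heq h0).trans g0) (hpos.trans_eq (heq h1).symm)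
    rw [I_congr heq h1, I_congr (I_congr heq) h1] at key
    simpa using key
  · rintro ⟨ha, hab, hbc⟩
    have hc : 0 < c := by
      by_contra! hle
      nlinarith [sq_nonneg b]
    obtain ⟨g, gc, gm, g0, g1, gI, gII⟩ := exists_of_moments (m := b / c) (s := 2 * a / c)
      (by rw [div_pow, div_lt_div_iff₀ (by positivity) hc]; nlinarith)
      (by gcongr)
    refine ⟨fun t => c * g t + 0 * g t, by fun_prop, ?_,
      ⟨0, ⟨le_rfl, zero_le_one⟩, 1, ⟨zero_le_one, le_rfl⟩, ?_⟩, ?_, ?_, ?_, ?_⟩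
    · simpa using (gm.const_mul hc.le).monotoneOn _
    · simp [g0, g1, hc.ne]
    · simp [g0]
    · simp [g1]
    · rw [I_linear_comb gc gc]
      simp only [gI]
      field_simp
      ring
    · rw [I_linear_comb gc gc, I_linear_comb (continuous_I gc) (continuous_I gc)]
      simp only [gII]
      field_simp
      ring
end

section
/- For real numbers a, b, c, d, the following are equivalent: (i) there exists a continuous increasing function g : [0,1] → ℝ that is not constant, with g(0) = 0, g(1) = d, I(g)(1) = c, I²(g)(1) = b, and I³(g)(1) = a; (ii) 0 < c < d, 2b² < 3ac, and 6ad + c² + 4b² < 6ac + 2bc + 2bd. (This characterizes the set W₃ of possible tuples (D⁰f(1), D¹f(1), D²f(1), D³f(1)) for C³ functions f on [0,1] with D³f increasing and nonconstant and D^jf(0) = 0 for j = 0,1,2,3, via g = D³f.) -/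
open Set

open Filter Topology in
/-- Strict Cauchy–Schwarz inequality for the moments of the nonatomic measure `-dh`. -/
theorem sq_moment_lt_of_antitoneOn {h : ℝ → ℝ} (hc : Continuous h)
    (hanti : AntitoneOn h (Icc 0 1)) (h1 : h 1 = 0) (h0 : 0 < h 0) :
    0 < (∫ s in (0:ℝ)..1, h s) ∧
      4 * (∫ s in (0:ℝ)..1, s * h s) ^ 2 <
        3 * (∫ s in (0:ℝ)..1, h s) * ∫ s in (0:ℝ)..1, s ^ 2 * h s := by
  have hnn : ∀ s ∈ Icc (0:ℝ) 1, 0 ≤ h s := fun s hs => by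
    rw [← h1]; exact hanti hs ⟨zero_le_one, le_rfl⟩ hs.2
  have hJ0 : 0 < ∫ s in (0:ℝ)..1, h s :=
    intervalIntegral.integral_pos zero_lt_one hc.continuousOn
      (fun x hx => hnn x ⟨hx.1.le, hx.2⟩) ⟨0, ⟨le_rfl, zero_le_one⟩, h0⟩
  have hJ1 : 0 < ∫ s in (0:ℝ)..1, s * h s := by
    obtain ⟨x, hx, hx0⟩ : ∃ x ∈ Ioo (0:ℝ) 1, 0 < h x := by
      have := ((hc.tendsto 0).eventually (lt_mem_nhds h0)).filter_mono
        (nhdsWithin_le_nhds (s := Ioi 0))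
      obtain ⟨x, hx, hx'⟩ := (this.and (Ioo_mem_nhdsGT zero_lt_one)).exists
      exact ⟨x, hx', hx⟩
    exact intervalIntegral.integral_pos zero_lt_one (by fun_prop)
      (fun x hx => mul_nonneg hx.1.le (hnn x ⟨hx.1.le, hx.2⟩))
      ⟨x, ⟨hx.1.le, hx.2.le⟩, mul_pos hx.1 hx0⟩
  have hJ01 : 2 * (∫ s in (0:ℝ)..1, s * h s) < ∫ s in (0:ℝ)..1, h s := by
    have hm : (1 / 2 : ℝ) ∈ Icc (0:ℝ) 1 := by norm_num
    have key : 0 < ∫ s in (0:ℝ)..1, (1 - 2 * s) * (h s - h (1 / 2)) := by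
      refine intervalIntegral.integral_pos zero_lt_one (by fun_prop) ?_ ?_
      · intro x hx
        rcases le_total x (1 / 2) with hx2 | hx2
        · have := hanti ⟨hx.1.le, hx.2⟩ hm hx2
          exact mul_nonneg (by linarith) (by linarith)
        · have := hanti hm ⟨hx.1.le, hx.2⟩ hx2
          exact mul_nonneg_of_nonpos_of_nonpos (by linarith) (by linarith)
      · rcases lt_or_ge (h (1 / 2)) (h 0) with hlt | hge
        · exact ⟨0, by norm_num, by linarith⟩
        · exact ⟨1, by norm_num, by linarith⟩
    have hpoly : ∫ s in (0:ℝ)..1, (1 - 2 * s) * h (1 / 2) = 0 := by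
      rw [intervalIntegral.integral_eq_sub_of_hasDerivAt (f := fun s => (s - s ^ 2) * h (1 / 2))]
      · simp
      · intro x _
        exact (((hasDerivAt_id x).sub ((hasDerivAt_id x).pow 2)).mul_const
          (h (1 / 2))).congr_deriv (by simp)
      · exact Continuous.intervalIntegrable (by fun_prop) _ _
    have e : ∫ s in (0:ℝ)..1, (1 - 2 * s) * (h s - h (1 / 2)) =
        (∫ s in (0:ℝ)..1, h s) - 2 * (∫ s in (0:ℝ)..1, s * h s) := by
      have : ∀ s, (1 - 2 * s) * (h s - h (1 / 2)) =
          h s - 2 * (s * h s) - (1 - 2 * s) * h (1 / 2) := fun s => by ring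
      simp only [this]
      rw [intervalIntegral.integral_sub
          (Continuous.intervalIntegrable (by fun_prop) _ _)
          (Continuous.intervalIntegrable (by fun_prop) _ _),
        intervalIntegral.integral_sub
          (Continuous.intervalIntegrable (by fun_prop) _ _)
          (Continuous.intervalIntegrable (by fun_prop) _ _), hpoly]
      simp
    linarith
  refine ⟨hJ0, ?_⟩
  set J0 := ∫ s in (0:ℝ)..1, h s with hJ0d
  set J1 := ∫ s in (0:ℝ)..1, s * h s with hJ1d
  set J2 := ∫ s in (0:ℝ)..1, s ^ 2 * h s with hJ2d
  obtain ⟨l, hl⟩ : ∃ l, l = 2 * J1 / J0 := ⟨_, rfl⟩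
  have hl0 : 0 < l := by rw [hl]; positivity
  have hl1 : l < 1 := by rw [hl, div_lt_one hJ0]; exact hJ01
  have hl3 : l / 3 ∈ Icc (0:ℝ) 1 := ⟨by linarith, by linarith⟩
  have etot : ∫ s in (0:ℝ)..1, (s - l) * (3 * s - l) * h s = 3 * J2 - 4 * l * J1 + l ^ 2 * J0 := by
    have : ∀ s, (s - l) * (3 * s - l) * h s =
        3 * (s ^ 2 * h s) - 4 * l * (s * h s) + l ^ 2 * h s := fun s => by ring
    simp only [this]
    rw [intervalIntegral.integral_add
        (Continuous.intervalIntegrable (by fun_prop) _ _)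
        (Continuous.intervalIntegrable (by fun_prop) _ _),
      intervalIntegral.integral_sub
        (Continuous.intervalIntegrable (by fun_prop) _ _)
        (Continuous.intervalIntegrable (by fun_prop) _ _)]
    simp [hJ0d, hJ1d, hJ2d]
  have esplit := intervalIntegral.integral_add_adjacent_intervals (μ := MeasureTheory.volume)
    (f := fun s => (s - l) * (3 * s - l) * h s) (a := 0) (b := l) (c := 1)
    (Continuous.intervalIntegrable (by fun_prop) _ _)
    (Continuous.intervalIntegrable (by fun_prop) _ _)
  have eleft : ∫ s in (0:ℝ)..l, (s - l) * (3 * s - l) * h s =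
      ∫ s in (0:ℝ)..l, (s - l) * (3 * s - l) * (h s - h (l / 3)) := by
    have hpoly : ∫ s in (0:ℝ)..l, (s - l) * (3 * s - l) * h (l / 3) = 0 := by
      rw [intervalIntegral.integral_eq_sub_of_hasDerivAt
        (f := fun s => s * (s - l) ^ 2 * h (l / 3))]
      · simp
      · intro x _
        exact (((hasDerivAt_id x).mul (((hasDerivAt_id x).sub_const l).pow 2)).mul_const
          (h (l / 3))).congr_deriv (by simp only [id, Pi.pow_apply]; push_cast; ring)
      · exact Continuous.intervalIntegrable (by fun_prop) _ _
    have hsub : ∀ s, (s - l) * (3 * s - l) * (h s - h (l / 3)) =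
        (s - l) * (3 * s - l) * h s - (s - l) * (3 * s - l) * h (l / 3) := fun s => by ring
    simp only [hsub]
    rw [intervalIntegral.integral_sub
        (Continuous.intervalIntegrable (by fun_prop) _ _)
        (Continuous.intervalIntegrable (by fun_prop) _ _), hpoly, sub_zero]
  have hnnL : ∀ x ∈ Ioc 0 l, 0 ≤ (x - l) * (3 * x - l) * (h x - h (l / 3)) := by
    intro x hx
    have hx01 : x ∈ Icc (0:ℝ) 1 := ⟨hx.1.le, by linarith [hx.2]⟩
    rcases le_total x (l / 3) with hx2 | hx2
    · have := hanti hx01 hl3 hx2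
      exact mul_nonneg (mul_nonneg_of_nonpos_of_nonpos (by linarith) (by linarith)) (by linarith)
    · have := hanti hl3 hx01 hx2
      exact mul_nonneg_of_nonpos_of_nonpos
        (mul_nonpos_of_nonpos_of_nonneg (by linarith [hx.2]) (by linarith)) (by linarith)
  have hnnR : ∀ x ∈ Ioc l 1, 0 ≤ (x - l) * (3 * x - l) * h x := by
    intro x hx
    exact mul_nonneg (mul_nonneg (by linarith [hx.1]) (by linarith [hx.1]))
      (hnn x ⟨by linarith [hx.1], hx.2⟩)
  have hL : 0 ≤ ∫ s in (0:ℝ)..l, (s - l) * (3 * s - l) * (h s - h (l / 3)) := by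
    rw [intervalIntegral.integral_of_le hl0.le]
    exact MeasureTheory.setIntegral_nonneg measurableSet_Ioc hnnL
  have hR : 0 ≤ ∫ s in l..1, (s - l) * (3 * s - l) * h s := by
    rw [intervalIntegral.integral_of_le hl1.le]
    exact MeasureTheory.setIntegral_nonneg measurableSet_Ioc hnnR
  have hpos : 0 < 3 * J2 - 4 * l * J1 + l ^ 2 * J0 := by
    rw [← etot, ← esplit, eleft]
    by_contra! hcon
    have hL' : ∀ x ∈ Icc 0 l, (x - l) * (3 * x - l) * (h x - h (l / 3)) ≤ 0 := by
      by_contra! hx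
      have := intervalIntegral.integral_pos hl0
        (f := fun s => (s - l) * (3 * s - l) * (h s - h (l / 3))) (by fun_prop) hnnL hx
      linarith
    have hR' : ∀ x ∈ Icc l 1, (x - l) * (3 * x - l) * h x ≤ 0 := by
      by_contra! hx
      have := intervalIntegral.integral_pos hl1
        (f := fun s => (s - l) * (3 * s - l) * h s) (by fun_prop) hnnR hx
      linarith
    have a0 : h 0 ≤ h (l / 3) := by
      have := hL' 0 ⟨le_rfl, hl0.le⟩
      by_contra! hh
      have := mul_pos (mul_pos hl0 hl0) (sub_pos.2 hh)
      linarith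
    have a1 : h (l / 3) ≤ h l := by
      refine ge_of_tendsto ((hc.tendsto l).mono_left (nhdsWithin_le_nhds (s := Iio l))) ?_
      filter_upwards [Ioo_mem_nhdsLT (show l / 3 < l by linarith)] with x hx
      have := hL' x ⟨by linarith [hx.1], hx.2.le⟩
      by_contra! hh
      have := mul_pos (mul_pos (show 0 < l - x by linarith [hx.2])
        (show 0 < 3 * x - l by linarith [hx.1])) (sub_pos.2 hh)
      linarith
    have a2 : h l ≤ 0 := by
      refine le_of_tendsto ((hc.tendsto l).mono_left (nhdsWithin_le_nhds (s := Ioi l))) ?_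
      filter_upwards [Ioo_mem_nhdsGT hl1] with x hx
      have := hR' x ⟨hx.1.le, hx.2.le⟩
      by_contra! hh
      have := mul_pos (mul_pos (show 0 < x - l by linarith [hx.1])
        (show 0 < 3 * x - l by linarith [hx.1])) hh
      linarith
    linarith
  have hlJ : l * J0 = 2 * J1 := by rw [hl]; field_simp
  have := mul_pos hpos hJ0
  have e : (3 * J2 - 4 * l * J1 + l ^ 2 * J0) * J0 = 3 * J0 * J2 - 4 * J1 ^ 2 := by
    linear_combination (-4 * J1 + l * J0 + 2 * J1) * hlJ
  linarith

theorem I_I_one {g : ℝ → ℝ} (hg : Continuous g) :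
    I (I g) 1 = ∫ t in (0:ℝ)..1, (1 - t) * g t := by
  have hI := continuous_I hg
  have := intervalIntegral.integral_eq_sub_of_hasDerivAt (a := 0) (b := 1)
    (f := fun t => (1 - t) * I g t + I (I g) t) (f' := fun t => (1 - t) * g t)
    (fun x _ => ((((hasDerivAt_id x).const_sub 1).mul (hasDerivAt_I hg x)).add
      (hasDerivAt_I hI x)).congr_deriv (by simp))
    (Continuous.intervalIntegrable (by fun_prop) _ _)
  rw [this]
  simp [I_zero]

theorem I_I_I_one {g : ℝ → ℝ} (hg : Continuous g) :
    I (I (I g)) 1 = (∫ t in (0:ℝ)..1, (1 - t) ^ 2 * g t) / 2 := by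
  have hI := continuous_I hg
  have hII := continuous_I hI
  have := intervalIntegral.integral_eq_sub_of_hasDerivAt (a := 0) (b := 1)
    (f := fun t => (1 - t) ^ 2 * I g t + 2 * ((1 - t) * I (I g) t + I (I (I g)) t))
    (f' := fun t => (1 - t) ^ 2 * g t)
    (fun x _ => (((((hasDerivAt_id x).const_sub 1).pow 2).mul (hasDerivAt_I hg x)).add
      (((((hasDerivAt_id x).const_sub 1).mul (hasDerivAt_I hI x)).add
        (hasDerivAt_I hII x)).const_mul 2)).congr_deriv (by simp; ring))
    (Continuous.intervalIntegrable (by fun_prop) _ _)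
  rw [this]
  simp [I_zero]

/-- The integrals of a nonconstant increasing continuous function satisfy the moment inequalities. -/
theorem moment_inequalities {g : ℝ → ℝ} (hc : Continuous g) (hmono : MonotoneOn g (Icc 0 1))
    (h0 : g 0 = 0) (h1 : 0 < g 1) :
    0 < I g 1 ∧ I g 1 < g 1 ∧ 2 * I (I g) 1 ^ 2 < 3 * I (I (I g)) 1 * I g 1 ∧
      6 * I (I (I g)) 1 * g 1 + I g 1 ^ 2 + 4 * I (I g) 1 ^ 2 <
        6 * I (I (I g)) 1 * I g 1 + 2 * I (I g) 1 * I g 1 + 2 * I (I g) 1 * g 1 := by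
  obtain ⟨p, hp⟩ := sq_moment_lt_of_antitoneOn (h := fun s => g (1 - s)) (by fun_prop)
    (fun x hx y hy hxy => hmono ⟨by linarith [hy.2], by linarith [hy.1]⟩
      ⟨by linarith [hx.2], by linarith [hx.1]⟩ (by linarith)) (by simpa) (by simpa)
  obtain ⟨q, hq⟩ := sq_moment_lt_of_antitoneOn (h := fun s => g 1 - g s) (by fun_prop)
    (fun x hx y hy hxy => by have := hmono hx hy hxy; simp only; linarith) (by simp) (by simpa [h0])
  have e0 : ∫ s in (0:ℝ)..1, g (1 - s) = I g 1 := by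
    rw [intervalIntegral.integral_comp_sub_left (fun s => g s)]; simp [I]
  have e1 : ∫ s in (0:ℝ)..1, s * g (1 - s) = I (I g) 1 := by
    have := intervalIntegral.integral_comp_sub_left (a := 0) (b := 1)
      (fun s => (1 - s) * g s) (1:ℝ)
    simp only [sub_sub_cancel, sub_self, sub_zero] at this
    rw [this, I_I_one hc]
  have e2 : ∫ s in (0:ℝ)..1, s ^ 2 * g (1 - s) = 2 * I (I (I g)) 1 := by
    have := intervalIntegral.integral_comp_sub_left (a := 0) (b := 1)
      (fun s => (1 - s) ^ 2 * g s) (1:ℝ)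
    simp only [sub_sub_cancel, sub_self, sub_zero] at this
    rw [this, I_I_I_one hc]; ring
  have f1 : ∫ s in (0:ℝ)..1, s * g s = I g 1 - I (I g) 1 := by
    rw [I_I_one hc, I, ← intervalIntegral.integral_sub
      (Continuous.intervalIntegrable (by fun_prop) _ _)
      (Continuous.intervalIntegrable (by fun_prop) _ _)]
    congr 1; ext s; ring
  have f2 : ∫ s in (0:ℝ)..1, s ^ 2 * g s = 2 * I (I (I g)) 1 - I g 1 + 2 * (I g 1 - I (I g) 1) := by
    rw [← f1, I_I_I_one hc, I, mul_div_cancel₀ _ two_ne_zero,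
      ← intervalIntegral.integral_const_mul,
      ← intervalIntegral.integral_sub
      (Continuous.intervalIntegrable (by fun_prop) _ _)
      (Continuous.intervalIntegrable (by fun_prop) _ _), ← intervalIntegral.integral_add
      (Continuous.intervalIntegrable (by fun_prop) _ _)
      (Continuous.intervalIntegrable (by fun_prop) _ _)]
    congr 1; ext s; ring
  have k0 : ∫ s in (0:ℝ)..1, (g 1 - g s) = g 1 - I g 1 := by
    rw [intervalIntegral.integral_sub
      (Continuous.intervalIntegrable (by fun_prop) _ _)
      (Continuous.intervalIntegrable (by fun_prop) _ _)]
    simp [I]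
  have k1 : ∫ s in (0:ℝ)..1, s * (g 1 - g s) = g 1 / 2 - (I g 1 - I (I g) 1) := by
    simp only [mul_sub]
    rw [intervalIntegral.integral_sub
      (Continuous.intervalIntegrable (by fun_prop) _ _)
      (Continuous.intervalIntegrable (by fun_prop) _ _), f1]
    simp; ring
  have k2 : ∫ s in (0:ℝ)..1, s ^ 2 * (g 1 - g s) =
      g 1 / 3 - (2 * I (I (I g)) 1 - I g 1 + 2 * (I g 1 - I (I g) 1)) := by
    simp only [mul_sub]
    rw [intervalIntegral.integral_sub
      (Continuous.intervalIntegrable (by fun_prop) _ _)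
      (Continuous.intervalIntegrable (by fun_prop) _ _), f2]
    simp; ring
  rw [e0] at p
  rw [e0, e1, e2] at hp
  rw [k0] at q
  rw [k0, k1, k2] at hq
  exact ⟨p, by linarith, by linarith, by linarith⟩

/-- A sequence of moments in the interior of the moment space of `[0, r]` is represented by atoms
at `0`, at an interior point, and at `r`. -/
theorem exists_three_atoms {r n0 n1 n2 n3 : ℝ} (hr : 0 < r) (h1 : 0 < n1) (h01 : n1 < r * n0)
    (hA : n2 ^ 2 < n1 * n3) (hB : (r * n1 - n2) ^ 2 < (r * n0 - n1) * (r * n2 - n3)) :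
    ∃ y w0 w w1 : ℝ, 0 ≤ y ∧ y ≤ r ∧ 0 ≤ w0 ∧ 0 ≤ w ∧ 0 ≤ w1 ∧ n0 = w0 + w + w1 ∧
      n1 = w * y + w1 * r ∧ n2 = w * y ^ 2 + w1 * r ^ 2 ∧ n3 = w * y ^ 3 + w1 * r ^ 3 := by
  have h3 : 0 < n3 := pos_of_mul_pos_right ((sq_nonneg _).trans_lt hA) h1.le
  have h23 : 0 < r * n2 - n3 :=
    pos_of_mul_pos_right ((sq_nonneg _).trans_lt hB) (by linarith)
  have h2 : 0 < n2 := pos_of_mul_pos_right (by linarith : 0 < r * n2) hr.le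
  have h12 : 0 < r * n1 - n2 := by
    have : n2 * n2 < n2 * (r * n1) := by nlinarith
    linarith [lt_of_mul_lt_mul_left this h2.le]
  have hD : 0 < r ^ 2 * n1 - 2 * r * n2 + n3 := by
    refine pos_of_mul_pos_right (?_ : 0 < n1 * _) h1.le
    nlinarith [sq_nonneg (r * n1 - n2)]
  set u := r * n1 - n2 with hu
  set v := r * n2 - n3 with hv
  have hD' : 0 < r * u - v := by rw [hu, hv]; linarith
  obtain ⟨z, hz⟩ : ∃ z, z = r * u - v := ⟨_, rfl⟩
  rw [← hz] at hD'
  refine ⟨v / u, n0 - u ^ 3 / (v * z) - (n1 - u ^ 2 / z) / r,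
    u ^ 3 / (v * z), (n1 - u ^ 2 / z) / r, by positivity, ?_, ?_,
    by positivity, ?_, by ring, ?_, ?_, ?_⟩
  · rw [div_le_iff₀ h12]; linarith
  · have e : n0 - u ^ 3 / (v * z) - (n1 - u ^ 2 / z) / r =
        ((r * n0 - n1) * v - u ^ 2) / (r * v) := by
      field_simp; rw [hz]; ring
    rw [e]
    exact div_nonneg (by linarith) (by positivity)
  · refine div_nonneg ?_ hr.le
    rw [sub_nonneg, div_le_iff₀ hD']
    rw [hz, hv, hu]; nlinarith
  · field_simp; ring
  · field_simp; rw [hz, hv, hu]; ring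
  · field_simp; rw [hz, hv, hu]; ring

theorem integral_mul_max {f : ℝ → ℝ} (hf : Continuous f) {p : ℝ} (hp : p ∈ Icc (0:ℝ) 1) :
    ∫ t in (0:ℝ)..1, f t * max (t - p) 0 = ∫ t in p..1, f t * (t - p) := by
  rw [← intervalIntegral.integral_add_adjacent_intervals (b := p)
    (Continuous.intervalIntegrable (by fun_prop) _ _)
    (Continuous.intervalIntegrable (by fun_prop) _ _)]
  have e1 : ∫ t in (0:ℝ)..p, f t * max (t - p) 0 = ∫ t in (0:ℝ)..p, (0:ℝ) := by
    refine intervalIntegral.integral_congr fun t ht => ?_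
    rw [uIcc_of_le hp.1] at ht
    simp [ht.2]
  have e2 : ∫ t in p..1, f t * max (t - p) 0 = ∫ t in p..1, f t * (t - p) := by
    refine intervalIntegral.integral_congr fun t ht => ?_
    rw [uIcc_of_le hp.2] at ht
    simp [ht.1]
  rw [e1, e2]; simp

theorem integral_pow_mul_max (k : ℕ) {p : ℝ} (hp : p ∈ Icc (0:ℝ) 1) :
    ∫ t in (0:ℝ)..1, (1 - t) ^ k * max (t - p) 0 = (1 - p) ^ (k + 2) / ((k + 1) * (k + 2)) := by
  rw [integral_mul_max (f := fun t => (1 - t) ^ k) (by fun_prop) hp]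
  have hk1 : (k + 1 : ℝ) ≠ 0 := by positivity
  have hk2 : (k + 2 : ℝ) ≠ 0 := by positivity
  rw [intervalIntegral.integral_eq_sub_of_hasDerivAt
    (f := fun t => (1 - t) ^ (k + 2) / (k + 2) - (1 - p) * (1 - t) ^ (k + 1) / (k + 1))]
  · simp; field_simp; ring
  · intro x _
    refine (((((hasDerivAt_id x).const_sub 1).pow (k + 2)).div_const (k + 2 : ℝ)).sub
      (((((hasDerivAt_id x).const_sub 1).pow (k + 1)).const_mul (1 - p)).div_const
        (k + 1 : ℝ))).congr_deriv ?_
    simp; field_simp; ring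
  · exact Continuous.intervalIntegrable (by fun_prop) _ _

/-- The distribution function of the uniform law on `[p, p + e]`. -/
noncomputable def ramp (e p t : ℝ) : ℝ := (max (t - p) 0 - max (t - (p + e)) 0) / e

theorem continuous_ramp (e p : ℝ) : Continuous (ramp e p) := by
  unfold ramp; fun_prop

theorem monotone_ramp {e : ℝ} (he : 0 < e) (p : ℝ) : Monotone (ramp e p) := by
  intro x y hxy
  unfold ramp
  gcongr ?_ / _
  grind

theorem ramp_zero {e p : ℝ} (he : 0 < e) (hp : 0 ≤ p) : ramp e p 0 = 0 := by
  rw [ramp, max_eq_right (by linarith), max_eq_right (by linarith)]; simp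

theorem ramp_one {e p : ℝ} (he : 0 < e) (hp : p + e ≤ 1) : ramp e p 1 = 1 := by
  rw [ramp, max_eq_left (by linarith), max_eq_left (by linarith)]; field_simp; ring

theorem integral_pow_mul_ramp (k : ℕ) {e y : ℝ} (he : 0 < e) (hy : 0 ≤ y) (hye : y + e ≤ 1) :
    ∫ t in (0:ℝ)..1, (1 - t) ^ k * ramp e (1 - y - e) t =
      ((y + e) ^ (k + 2) - y ^ (k + 2)) / ((k + 1) * (k + 2) * e) := by
  have : ∀ t, (1 - t) ^ k * ramp e (1 - y - e) t =
      ((1 - t) ^ k * max (t - (1 - y - e)) 0 - (1 - t) ^ k * max (t - (1 - y)) 0) / e := by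
    intro t; rw [ramp, show 1 - y - e + e = 1 - y by ring]; ring
  simp only [this]
  rw [intervalIntegral.integral_div, intervalIntegral.integral_sub
      (Continuous.intervalIntegrable (by fun_prop) _ _)
      (Continuous.intervalIntegrable (by fun_prop) _ _),
    integral_pow_mul_max k ⟨by linarith, by linarith⟩,
    integral_pow_mul_max k ⟨by linarith, by linarith⟩]
  rw [show 1 - (1 - y - e) = y + e by ring, show 1 - (1 - y) = y by ring]
  have hk1 : (k + 1 : ℝ) ≠ 0 := by positivity
  have hk2 : (k + 2 : ℝ) ≠ 0 := by positivity
  field_simp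

theorem integral_pow_mul_ramp_comb (k : ℕ) {e y0 y1 y2 : ℝ} (w0 w1 w2 : ℝ) (he : 0 < e)
    (h0 : y0 ∈ Icc 0 (1 - e)) (h1 : y1 ∈ Icc 0 (1 - e)) (h2 : y2 ∈ Icc 0 (1 - e)) :
    ∫ t in (0:ℝ)..1, (1 - t) ^ k * (w0 * ramp e (1 - y0 - e) t + w1 * ramp e (1 - y1 - e) t +
        w2 * ramp e (1 - y2 - e) t) =
      (w0 * ((y0 + e) ^ (k + 2) - y0 ^ (k + 2)) + w1 * ((y1 + e) ^ (k + 2) - y1 ^ (k + 2)) +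
        w2 * ((y2 + e) ^ (k + 2) - y2 ^ (k + 2))) / ((k + 1) * (k + 2) * e) := by
  have : ∀ t, (1 - t) ^ k * (w0 * ramp e (1 - y0 - e) t + w1 * ramp e (1 - y1 - e) t +
        w2 * ramp e (1 - y2 - e) t) =
      w0 * ((1 - t) ^ k * ramp e (1 - y0 - e) t) + w1 * ((1 - t) ^ k * ramp e (1 - y1 - e) t) +
        w2 * ((1 - t) ^ k * ramp e (1 - y2 - e) t) := fun t => by ring
  simp only [this]
  have c0 := continuous_ramp e (1 - y0 - e)
  have c1 := continuous_ramp e (1 - y1 - e)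
  have c2 := continuous_ramp e (1 - y2 - e)
  rw [intervalIntegral.integral_add
      (Continuous.intervalIntegrable (by fun_prop) _ _)
      (Continuous.intervalIntegrable (by fun_prop) _ _),
    intervalIntegral.integral_add
      (Continuous.intervalIntegrable (by fun_prop) _ _)
      (Continuous.intervalIntegrable (by fun_prop) _ _)]
  simp only [intervalIntegral.integral_const_mul]
  rw [integral_pow_mul_ramp k he h0.1 (by linarith [h0.2]),
    integral_pow_mul_ramp k he h1.1 (by linarith [h1.2]),
    integral_pow_mul_ramp k he h2.1 (by linarith [h2.2])]
  ring

open Filter Topology in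
theorem exists_of_moment_inequalities {a b c d : ℝ} (hc : 0 < c) (hcd : c < d)
    (hA : 2 * b ^ 2 < 3 * a * c)
    (hB : 6 * a * d + c ^ 2 + 4 * b ^ 2 < 6 * a * c + 2 * b * c + 2 * b * d) :
    ∃ g : ℝ → ℝ, Continuous g ∧ Monotone g ∧ g 0 = 0 ∧ g 1 = d ∧ I g 1 = c ∧
      I (I g) 1 = b ∧ I (I (I g)) 1 = a := by
  obtain ⟨n1, hn1⟩ : ∃ n1 : ℝ → ℝ, n1 = fun e => c - e * d / 2 := ⟨_, rfl⟩
  obtain ⟨n2, hn2⟩ : ∃ n2 : ℝ → ℝ, n2 = fun e => 2 * b - e * n1 e - e ^ 2 * d / 3 := ⟨_, rfl⟩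
  obtain ⟨n3, hn3⟩ : ∃ n3 : ℝ → ℝ,
      n3 = fun e => 6 * a - 3 / 2 * e * n2 e - e ^ 2 * n1 e - e ^ 3 * d / 4 := ⟨_, rfl⟩
  have c1 : Continuous n1 := by rw [hn1]; fun_prop
  have c2 : Continuous n2 := by rw [hn2]; fun_prop
  have c3 : Continuous n3 := by rw [hn3]; fun_prop
  have z1 : n1 0 = c := by simp [hn1]
  have z2 : n2 0 = 2 * b := by simp [hn2]
  have z3 : n3 0 = 6 * a := by simp [hn3]
  have ev : ∀ {f g : ℝ → ℝ}, Continuous f → Continuous g → f 0 < g 0 →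
      ∀ᶠ e in 𝓝[>] (0:ℝ), f e < g e := fun hf hg h =>
    ((hf.tendsto 0).eventually_lt (hg.tendsto 0) h).filter_mono nhdsWithin_le_nhds
  have E1 := ev continuous_const c1 (by rw [z1]; exact hc)
  have E2 := ev c1 (g := fun e => (1 - e) * d) (by fun_prop) (by simpa [z1])
  have E3 := ev (f := fun e => n2 e ^ 2) (g := fun e => n1 e * n3 e) (by fun_prop) (by fun_prop)
    (by simp only [z1, z2, z3]; linarith)
  have E4 := ev (f := fun e => ((1 - e) * n1 e - n2 e) ^ 2)
    (g := fun e => ((1 - e) * d - n1 e) * ((1 - e) * n2 e - n3 e)) (by fun_prop) (by fun_prop)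
    (by simp only [z1, z2, z3]; linarith)
  obtain ⟨e, h1, h2, h3, h4, he⟩ :=
    (E1.and (E2.and (E3.and (E4.and (Ioo_mem_nhdsGT (zero_lt_one (α := ℝ))))))).exists
  have he0 : 0 < e := he.1
  have he1 : e < 1 := he.2
  obtain ⟨y, w0, w, w1, hy0, hyr, hw0, hw, hw1, m0, m1, m2, m3⟩ :=
    exists_three_atoms (sub_pos.2 he1) h1 h2 h3 h4
  have hz : (0:ℝ) ∈ Icc 0 (1 - e) := ⟨le_rfl, by linarith⟩
  have hr : 1 - e ∈ Icc 0 (1 - e) := ⟨by linarith, le_rfl⟩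
  have hy : y ∈ Icc 0 (1 - e) := ⟨hy0, hyr⟩
  have M := fun k => integral_pow_mul_ramp_comb k w0 w w1 he0 hz hy hr
  have hcont : Continuous fun t => w0 * ramp e (1 - 0 - e) t + w * ramp e (1 - y - e) t +
      w1 * ramp e (1 - (1 - e) - e) t := by
    have c0 := continuous_ramp e (1 - 0 - e)
    have c1 := continuous_ramp e (1 - y - e)
    have c2 := continuous_ramp e (1 - (1 - e) - e)
    fun_prop
  have hb : 2 * b = n2 e + e * n1 e + e ^ 2 * d / 3 := by rw [hn2]; ring
  have ha : 6 * a = n3 e + 3 / 2 * e * n2 e + e ^ 2 * n1 e + e ^ 3 * d / 4 := by rw [hn3]; ring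
  have hc' : c = n1 e + e * d / 2 := by rw [hn1]; ring
  refine ⟨_, hcont, ?_, ?_, ?_, ?_, ?_, ?_⟩
  · intro s t hst
    have r0 := monotone_ramp he0 (1 - 0 - e) hst
    have r1 := monotone_ramp he0 (1 - y - e) hst
    have r2 := monotone_ramp he0 (1 - (1 - e) - e) hst
    dsimp only
    gcongr
  · rw [ramp_zero he0 (by linarith), ramp_zero he0 (by linarith), ramp_zero he0 (by linarith)]
    simp
  · rw [ramp_one he0 (by linarith), ramp_one he0 (by linarith), ramp_one he0 (by linarith)]
    linarith
  · have := M 0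
    simp only [pow_zero, one_mul] at this
    rw [I, this, hc', m0, m1]
    push_cast; field_simp; ring
  · have := M 1
    simp only [pow_one] at this
    rw [I_I_one hcont, this]
    rw [m0, m1, m2] at hb
    rw [show b = 2 * b / 2 by ring, hb]
    push_cast; field_simp; ring
  · rw [I_I_I_one hcont, M 2]
    rw [m0, m1, m2, m3] at ha
    rw [show a = 6 * a / 6 by ring, ha]
    push_cast; field_simp; ring

theorem stmt5 (a b c d : ℝ) :
    (∃ g : ℝ → ℝ, ContinuousOn g (Icc 0 1) ∧ MonotoneOn g (Icc 0 1) ∧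
      (∃ x ∈ Icc (0:ℝ) 1, ∃ y ∈ Icc (0:ℝ) 1, g x ≠ g y) ∧
      g 0 = 0 ∧ g 1 = d ∧ I g 1 = c ∧ I (I g) 1 = b ∧ I (I (I g)) 1 = a) ↔
    (0 < c ∧ c < d ∧ 2 * b ^ 2 < 3 * a * c ∧
      6 * a * d + c ^ 2 + 4 * b ^ 2 < 6 * a * c + 2 * b * c + 2 * b * d) := by
  have m0 : (0:ℝ) ∈ Icc (0:ℝ) 1 := by norm_num
  have m1 : (1:ℝ) ∈ Icc (0:ℝ) 1 := by norm_num
  constructor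
  · rintro ⟨g, hg, hmono, ⟨x, hx, y, hy, hxy⟩, h0, rfl, rfl, rfl, rfl⟩
    have hext : EqOn (IccExtend zero_le_one ((Icc (0:ℝ) 1).domRestrict g)) g (Icc 0 1) :=
      fun t ht => by rw [IccExtend_of_mem _ _ ht]; rfl
    have hcont : Continuous (IccExtend zero_le_one ((Icc (0:ℝ) 1).domRestrict g)) :=
      hg.domRestrict.Icc_extend'
    have hpos : 0 < g 1 := by
      by_contra! hneg
      have hzero : ∀ t ∈ Icc (0:ℝ) 1, g t = 0 := fun t ht =>
        le_antisymm ((hmono ht m1 ht.2).trans hneg) (h0 ▸ hmono m0 ht ht.1)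
      exact hxy (by rw [hzero x hx, hzero y hy])
    have := moment_inequalities hcont (hmono.congr hext.symm)
      (by rw [hext m0, h0]) (by rwa [hext m1])
    rwa [hext m1, I_congr hext m1, I_congr (I_congr hext) m1,
      I_congr (I_congr (I_congr hext)) m1] at this
  · rintro ⟨hc, hcd, hA, hB⟩
    obtain ⟨g, hg, hmono, h0, h1, h⟩ := exists_of_moment_inequalities hc hcd hA hB
    exact ⟨g, hg.continuousOn, hmono.monotoneOn _,
      ⟨0, m0, 1, m1, by rw [h0, h1]; linarith⟩, h0, h1, h⟩
end

section
/- Let a, b, c, d be real numbers satisfying 0 < c < d, 2b² < 3ac, and 6ad + c² + 4b² < 6ac + 2bc + 2bd. Let (α_j)_{j≥1} be a sequence of reals such that either α_j = 0 for all j ≥ 1, or the least j ≥ 1 with α_j ≠ 0 satisfies α_j > 0. Let (β_j)_{j≥1} be a sequence of reals such that either β_j = 0 for all j ≥ 1, or the least j ≥ 1 with β_j ≠ 0 satisfies (−1)^{j+1}β_j > 0. Then there exists a C^∞ function g : ℝ → ℝ such that g'(x) > 0 for all x ∈ (0,1), g(0) = 0, g(1) = d, I(g)(1) = c, I²(g)(1)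 = b, I³(g)(1) = a, and for every j ≥ 1, the j-th derivative of g satisfies D^j g(0) = α_j and D^j g(1) = β_j. -/
open Set

/-- Two-atom Gauss quadrature on `(p, q)`. -/
theorem exists_two_atoms (p q m0 m1 m2 m3 : ℝ)
    (hl : 0 < m1 - p * m0) (hr : 0 < q * m0 - m1) (hpq : p < q)
    (hp : (m2 - p * m1) ^ 2 < (m1 - p * m0) * (m3 - p * m2))
    (hq : (q * m1 - m2) ^ 2 < (q * m0 - m1) * (q * m2 - m3)) :
    ∃ x ∈ Ioo p q, ∃ y ∈ Ioo p q, ∃ w v : ℝ, 0 < w ∧ 0 < v ∧ w + v = m0 ∧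
      w * x + v * y = m1 ∧ w * x ^ 2 + v * y ^ 2 = m2 ∧ w * x ^ 3 + v * y ^ 3 = m3 := by
  have hm0 : 0 < m0 := by
    by_contra! h
    nlinarith [mul_nonneg (sub_pos.2 hpq).le (neg_nonneg.2 h)]
  have hD : 0 < m0 * m2 - m1 ^ 2 := by
    have hA2 : 0 < m3 - p * m2 := by
      by_contra! h; nlinarith [sq_nonneg (m2 - p * m1), mul_nonneg hl.le (neg_nonneg.2 h)]
    have hB2 : 0 < q * m2 - m3 := by
      by_contra! h; nlinarith [sq_nonneg (q * m1 - m2), mul_nonneg hr.le (neg_nonneg.2 h)]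
    have key : ((m2 - p * m1) + (q * m1 - m2)) ^ 2 <
        ((m1 - p * m0) + (q * m0 - m1)) * ((m3 - p * m2) + (q * m2 - m3)) := by
      generalize m2 - p * m1 = B at *
      generalize m1 - p * m0 = A at *
      generalize m3 - p * m2 = C at *
      generalize q * m1 - m2 = B' at *
      generalize q * m0 - m1 = A' at *
      generalize q * m2 - m3 = C' at *
      have h1 : B ^ 2 * B' ^ 2 ≤ (A * C) * (A' * C') :=
        mul_le_mul hp.le hq.le (sq_nonneg _) (by positivity)
      have h2 : 2 * (B * B') ≤ A * C' + A' * C := by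
        refine le_of_sq_le_sq ?_ (by positivity)
        nlinarith [sq_nonneg (A * C' - A' * C)]
      nlinarith
    have e : (q - p) ^ 2 * (m0 * m2 - m1 ^ 2) > 0 := by nlinarith
    exact pos_of_mul_pos_right e (by positivity)
  set D := m0 * m2 - m1 ^ 2 with hDdef
  set P : ℝ → ℝ := fun x => D * x ^ 2 - (m0 * m3 - m1 * m2) * x + (m1 * m3 - m2 ^ 2) with hP
  have hPc : Continuous P := by fun_prop
  have hPp : 0 < P p := by simp only [hP, hDdef]; nlinarith
  have hPq : 0 < P q := by simp only [hP, hDdef]; nlinarith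
  set z := m1 / m0 with hz
  have hzm : m1 = z * m0 := by rw [hz]; field_simp
  have hpz : p < z := by rw [hz, lt_div_iff₀ hm0]; linarith
  have hzq : z < q := by rw [hz, div_lt_iff₀ hm0]; linarith
  have hPz : P z < 0 := by
    have : m0 ^ 2 * P z = - D ^ 2 := by
      simp only [hP, hDdef]; rw [hzm]; ring
    have h2 : m0 ^ 2 * P z < 0 := by rw [this]; nlinarith
    exact neg_of_mul_neg_right h2 (by positivity)
  obtain ⟨x, hx, hx0⟩ := intermediate_value_Ioo' hpz.le hPc.continuousOn ⟨hPz, hPp⟩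
  obtain ⟨y, hy, hy0⟩ := intermediate_value_Ioo hzq.le hPc.continuousOn ⟨hPz, hPq⟩
  have hxy : 0 < y - x := by linarith [hx.2, hy.1]
  have hxm : 0 < m1 - m0 * x := by rw [hzm]; nlinarith [hx.2]
  have hym : 0 < m0 * y - m1 := by rw [hzm]; nlinarith [hy.1]
  refine ⟨x, ⟨hx.1, hx.2.trans hzq⟩, y, ⟨hpz.trans hy.1, hy.2⟩, (m0 * y - m1) / (y - x),
    (m1 - m0 * x) / (y - x), by positivity, by positivity, ?_⟩
  set w := (m0 * y - m1) / (y - x) with hw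
  set v := (m1 - m0 * x) / (y - x) with hv
  have E0 : w + v = m0 := by rw [hw, hv]; field_simp; ring
  have E1 : w * x + v * y = m1 := by rw [hw, hv]; field_simp; ring
  simp only [hP] at hx0 hy0
  have E2 : w * x ^ 2 + v * y ^ 2 = m2 := by
    apply mul_left_cancel₀ hD.ne'
    linear_combination w * hx0 + v * hy0 + (m0 * m3 - m1 * m2) * E1 - (m1 * m3 - m2 ^ 2) * E0
  have E3 : w * x ^ 3 + v * y ^ 3 = m3 := by
    apply mul_left_cancel₀ hD.ne'
    linear_combination w * x * hx0 + v * y * hy0 + (m0 * m3 - m1 * m2) * E2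
      - (m1 * m3 - m2 ^ 2) * E1
  exact ⟨E0, E1, E2, E3⟩

/-- A compactly supported smooth function agreeing with a monomial near `0`, all of whose
derivatives of order lower than the degree are small. -/
theorem exists_small_monomial (b ε : ℝ) (hε : 0 < ε) (i : ℕ) :
    ∃ f : ℝ → ℝ, ContDiff ℝ (⊤ : ℕ∞) f ∧ (f =ᶠ[nhds 0] fun x => b * x ^ i) ∧
      (∀ k, ∃ C, ∀ x, ‖iteratedDeriv k f x‖ ≤ C) ∧
      (∀ k < i, ∀ x, ‖iteratedDeriv k f x‖ ≤ ε) := by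
  let χ : ContDiffBump (0 : ℝ) := ⟨1, 2, one_pos, one_lt_two⟩
  let u : ℝ → ℝ := fun x => x ^ i * χ x
  have hu : ContDiff ℝ (⊤ : ℕ∞) u := (contDiff_id.pow i).mul χ.contDiff
  have hsupp : HasCompactSupport u := χ.hasCompactSupport.mul_left
  have hM : ∀ k, ∃ M, ∀ x, ‖iteratedDeriv k u x‖ ≤ M := by
    intro k
    obtain ⟨M, hM⟩ := (hsupp.iteratedFDeriv (𝕜 := ℝ) k).exists_bound_of_continuous
      (hu.continuous_iteratedFDeriv (m := k) (by exact_mod_cast le_top))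
    exact ⟨M, fun x => by rw [← norm_iteratedFDeriv_eq_norm_iteratedDeriv]; exact hM x⟩
  choose M hM using hM
  have hM0 : ∀ k, 0 ≤ M k := fun k => (norm_nonneg _).trans (hM k 0)
  set R : ℝ := max 1 (|b| * (∑ k ∈ Finset.range i, M k) / ε) with hR
  have hR1 : 1 ≤ R := le_max_left _ _
  have hR0 : 0 < R := by linarith
  have hRinv : ∀ n : ℕ, R⁻¹ ^ n * R ^ n = 1 := fun n => by
    rw [← mul_pow, inv_mul_cancel₀ hR0.ne', one_pow]
  have hder : ∀ k x, iteratedDeriv k (fun x => b * R⁻¹ ^ i * u (R * x)) x =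
      b * R⁻¹ ^ i * (R ^ k * iteratedDeriv k u (R * x)) := by
    intro k x
    rw [iteratedDeriv_const_mul_field, iteratedDeriv_comp_const_mul
      (hu.of_le (by exact_mod_cast le_top))]
  have hbd : ∀ k x, ‖iteratedDeriv k (fun x => b * R⁻¹ ^ i * u (R * x)) x‖ ≤
      |b| * R⁻¹ ^ i * R ^ k * M k := by
    intro k x
    rw [hder, norm_mul, norm_mul, norm_mul, Real.norm_eq_abs b, Real.norm_of_nonneg (by positivity),
      Real.norm_of_nonneg (by positivity : (0:ℝ) ≤ R ^ k), ← mul_assoc]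
    gcongr
    exact hM k _
  refine ⟨fun x => b * R⁻¹ ^ i * u (R * x), ?_, ?_, fun k => ⟨_, hbd k⟩, ?_⟩
  · exact contDiff_const.mul (hu.comp (contDiff_const.mul contDiff_id))
  · have h1 : Filter.Tendsto (fun x : ℝ => R * x) (nhds 0) (nhds 0) := by
      have : Continuous fun x : ℝ => R * x := by fun_prop
      simpa using this.tendsto 0
    filter_upwards [h1.eventually χ.eventuallyEq_one] with x hx
    simp only [u, hx, Pi.one_apply, mul_one, mul_pow]
    linear_combination b * x ^ i * hRinv i
  · intro k hk x
    refine (hbd k x).trans ?_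
    have h1 : R⁻¹ ^ i * R ^ k ≤ R⁻¹ := by
      obtain ⟨j, rfl⟩ := Nat.exists_eq_add_of_lt hk
      have : R⁻¹ ^ (k + j + 1) * R ^ k = R⁻¹ * R⁻¹ ^ j := by
        rw [pow_succ, pow_add]
        linear_combination R⁻¹ * R⁻¹ ^ j * hRinv k
      rw [this]
      exact mul_le_of_le_one_right (by positivity) (pow_le_one₀ (by positivity) (inv_le_one_of_one_le₀ hR1))
    have h2 : M k ≤ ∑ k ∈ Finset.range i, M k :=
      Finset.single_le_sum (fun j _ => hM0 j) (Finset.mem_range.2 hk)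
    have h3 : |b| * (∑ k ∈ Finset.range i, M k) ≤ R * ε := by
      rw [← div_le_iff₀ hε]; exact le_max_right _ _
    calc |b| * R⁻¹ ^ i * R ^ k * M k = |b| * (R⁻¹ ^ i * R ^ k) * M k := by ring
      _ ≤ |b| * R⁻¹ * ∑ k ∈ Finset.range i, M k := by
        gcongr
        exact hM0 k
      _ = R⁻¹ * (|b| * ∑ k ∈ Finset.range i, M k) := by ring
      _ ≤ R⁻¹ * (R * ε) := by gcongr
      _ = ε := by field_simp

/-- **Borel's lemma**: every real sequence is the sequence of derivatives at `0` of some smooth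
function. -/
theorem exists_contDiff_iteratedDeriv_eq (a : ℕ → ℝ) :
    ∃ f : ℝ → ℝ, ContDiff ℝ (⊤ : ℕ∞) f ∧ ∀ k, iteratedDeriv k f 0 = a k := by
  choose f hf hf0 hfC hfs using fun i : ℕ =>
    exists_small_monomial (a i / i.factorial) ((1 / 2 : ℝ) ^ i) (by positivity) i
  choose C hC using hfC
  let v : ℕ → ℕ → ℝ := fun k i => if k < i then (1 / 2 : ℝ) ^ i else C i k
  have hv : ∀ k : ℕ, (k : ℕ∞) ≤ ⊤ → Summable (v k) := fun k _ => by
    refine summable_geometric_two.congr_cofinite ?_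
    rw [Nat.cofinite_eq_atTop]
    filter_upwards [Filter.eventually_gt_atTop k] with i hi
    simp [v, hi]
  have hbd : ∀ (k i : ℕ) (x : ℝ), (k : ℕ∞) ≤ ⊤ → ‖iteratedFDeriv ℝ k (f i) x‖ ≤ v k i := by
    intro k i x _
    rw [norm_iteratedFDeriv_eq_norm_iteratedDeriv]
    by_cases h : k < i
    · simpa [v, h] using hfs i k h x
    · simpa [v, h] using hC i k x
  refine ⟨fun x => ∑' i, f i x, contDiff_tsum hf hv hbd, fun k => ?_⟩
  have hval : ∀ i, iteratedDeriv k (f i) 0 = if i = k then a k else 0 := by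
    intro i
    rw [(hf0 i).iteratedDeriv_eq, iteratedDeriv_const_mul_field, iteratedDeriv_fun_pow_zero]
    by_cases h : i = k
    · subst h
      simp [Nat.factorial_ne_zero]
    · simp [h, Ne.symm h]
  have hsum : Summable fun i => iteratedFDeriv ℝ k (f i) 0 :=
    .of_norm_bounded (hv k le_top) fun i => hbd k i 0 le_top
  rw [iteratedDeriv, iteratedFDeriv_tsum hf hv hbd le_top,
    ContinuousMultilinearMap.tsum_eval hsum]
  simp only [← iteratedDeriv_eq_iteratedFDeriv, hval]
  simp

/-- A smooth function whose first nonvanishing derivative at `0` is positive is positive on a right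
neighbourhood of `0`. -/
theorem eventually_pos_of_iteratedDeriv_pos (n : ℕ) (f : ℝ → ℝ) (hf : ContDiff ℝ (⊤ : ℕ∞) f)
    (h0 : ∀ i < n, iteratedDeriv i f 0 = 0) (hn : 0 < iteratedDeriv n f 0) :
    ∃ δ > 0, ∀ x ∈ Ioo 0 δ, 0 < f x := by
  induction n generalizing f with
  | zero =>
    rw [iteratedDeriv_zero] at hn
    obtain ⟨δ, hδ, h⟩ := Metric.eventually_nhds_iff.1
      (hf.continuous.continuousAt.eventually (lt_mem_nhds hn))
    exact ⟨δ, hδ, fun x hx => h (by rw [Real.dist_eq, sub_zero, abs_of_pos hx.1]; exact hx.2)⟩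
  | succ n ih =>
    obtain ⟨δ, hδ, h⟩ := ih (deriv f) (contDiff_infty_iff_deriv.1 hf).2
      (fun i hi => by rw [← iteratedDeriv_succ']; exact h0 _ (by omega))
      (by rwa [← iteratedDeriv_succ'])
    refine ⟨δ, hδ, fun x hx => ?_⟩
    have hmono : StrictMonoOn f (Icc 0 x) := by
      refine strictMonoOn_of_deriv_pos (convex_Icc _ _) hf.continuous.continuousOn fun y hy => ?_
      rw [interior_Icc] at hy
      exact h y ⟨hy.1, hy.2.trans hx.2⟩
    have := hmono (left_mem_Icc.2 hx.1.le) (right_mem_Icc.2 hx.1.le) hx.1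
    have h00 := h0 0 n.succ_pos
    rw [iteratedDeriv_zero] at h00
    linarith

/-- A smooth germ at `0` with prescribed derivatives, nonnegative and of small mass on `[0, 1]`. -/
theorem exists_nonneg_germ (a : ℕ → ℝ)
    (ha : (∀ j, a j = 0) ∨ ∃ j, (∀ i < j, a i = 0) ∧ 0 < a j) (ε : ℝ) (hε : 0 < ε) :
    ∃ f : ℝ → ℝ, ContDiff ℝ (⊤ : ℕ∞) f ∧ (∀ k, iteratedDeriv k f 0 = a k) ∧
      (∀ x ∈ Icc (0 : ℝ) 1, 0 ≤ f x) ∧ (∀ x, 1 / 2 ≤ x → f x = 0) ∧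
      ∫ x in (0 : ℝ)..1, f x ≤ ε := by
  rcases ha with ha | ⟨j, hj0, hj⟩
  · exact ⟨fun _ => 0, contDiff_const, fun k => by simp [ha], by simp, by simp,
      by simpa using hε.le⟩
  obtain ⟨u, hu, hua⟩ := exists_contDiff_iteratedDeriv_eq a
  obtain ⟨δ, hδ, hpos⟩ := eventually_pos_of_iteratedDeriv_pos j u hu
    (fun i hi => by rw [hua, hj0 i hi]) (by rwa [hua])
  obtain ⟨C, hC⟩ := isCompact_Icc.exists_bound_of_continuousOn (s := Icc (0 : ℝ) 1)
    hu.continuous.continuousOn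
  have hC0 : 0 ≤ C := (norm_nonneg _).trans (hC 0 (by simp))
  have hu0 : 0 ≤ u 0 := by
    have := hua 0
    rw [iteratedDeriv_zero] at this
    rw [this]
    rcases Nat.eq_zero_or_pos j with rfl | h
    · exact hj.le
    · exact (hj0 0 h).ge
  set r := min δ (min (1 / 2) (ε / (C + 1))) with hr
  have hr0 : 0 < r := by positivity
  have hrδ : r ≤ δ := min_le_left _ _
  have hr2 : r ≤ 1 / 2 := (min_le_right _ _).trans (min_le_left _ _)
  have hrε : C * r ≤ ε := by
    have : r ≤ ε / (C + 1) := (min_le_right _ _).trans (min_le_right _ _)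
    rw [le_div_iff₀ (by positivity)] at this
    nlinarith
  let χ : ContDiffBump (0 : ℝ) := ⟨r / 2, r, by positivity, by linarith⟩
  have hχ : ∀ x, r ≤ x → χ x = 0 := fun x hx => χ.zero_of_le_dist (by
    rw [Real.dist_eq, sub_zero]; exact hx.trans (le_abs_self x))
  have hcont : Continuous fun x => u x * χ x := hu.continuous.mul χ.continuous
  refine ⟨fun x => u x * χ x, hu.mul χ.contDiff, fun k => ?_, fun x hx => ?_, fun x hx => ?_, ?_⟩
  · rw [← hua k]
    refine Filter.EventuallyEq.iteratedDeriv_eq k ?_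
    filter_upwards [χ.eventuallyEq_one] with x hx
    simp [hx]
  · rcases le_or_gt r x with h | h
    · simp [hχ x h]
    · refine mul_nonneg ?_ χ.nonneg
      rcases hx.1.eq_or_lt with rfl | h'
      · exact hu0
      · exact (hpos x ⟨h', h.trans_le hrδ⟩).le
  · simp [hχ x (hr2.trans hx)]
  · rw [← intervalIntegral.integral_add_adjacent_intervals (hcont.intervalIntegrable 0 r)
      (hcont.intervalIntegrable r 1)]
    have h2 : ∫ x in r..1, u x * χ x = 0 := by
      refine intervalIntegral.integral_zero_ae (Filter.Eventually.of_forall fun x hx => ?_)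
      rw [uIoc_of_le (by linarith)] at hx
      simp [hχ x hx.1.le]
    have h1 : ‖∫ x in (0 : ℝ)..r, u x * χ x‖ ≤ C * |r - 0| := by
      refine intervalIntegral.norm_integral_le_of_norm_le_const fun x hx => ?_
      rw [uIoc_of_le hr0.le] at hx
      rw [norm_mul, Real.norm_of_nonneg χ.nonneg]
      calc _ ≤ C * 1 := by
            exact mul_le_mul (hC x ⟨hx.1.le, by linarith [hx.2]⟩) χ.le_one χ.nonneg hC0
        _ = C := mul_one C
    rw [sub_zero, abs_of_pos hr0] at h1
    rw [h2, add_zero]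
    exact (Real.le_norm_self _).trans (h1.trans hrε)

theorem iteratedDeriv_eq_zero_of_forall_lt (f : ℝ → ℝ) (hf : ContDiff ℝ (⊤ : ℕ∞) f) (a : ℝ)
    (h : ∀ x < a, f x = 0) (k : ℕ) : iteratedDeriv k f a = 0 := by
  have hc : Continuous (iteratedDeriv k f) := hf.continuous_iteratedDeriv k (by exact_mod_cast le_top)
  have h0 : ∀ x < a, iteratedDeriv k f x = 0 := fun x hx => by
    have : f =ᶠ[nhds x] fun _ => 0 := by
      filter_upwards [Iio_mem_nhds hx] with y hy using h y hy
    rw [this.iteratedDeriv_eq]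
    simp
  have hcl : IsClosed {x | iteratedDeriv k f x = 0} := isClosed_eq hc continuous_const
  have : closure (Iio a) ⊆ {x | iteratedDeriv k f x = 0} := closure_minimal h0 hcl
  rw [closure_Iio] at this
  exact this self_mem_Iic

/-- A smooth function which is positive on `(0, 1)`, of small mass, and has prescribed derivatives
at both endpoints. -/
theorem exists_pos_of_jets (a b : ℕ → ℝ)
    (ha : (∀ j, a j = 0) ∨ ∃ j, (∀ i < j, a i = 0) ∧ 0 < a j)
    (hb : (∀ j, b j = 0) ∨ ∃ j, (∀ i < j, b i = 0) ∧ 0 < (-1) ^ j * b j)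
    (ε : ℝ) (hε : 0 < ε) :
    ∃ f : ℝ → ℝ, ContDiff ℝ (⊤ : ℕ∞) f ∧ (∀ k, iteratedDeriv k f 0 = a k) ∧
      (∀ k, iteratedDeriv k f 1 = b k) ∧ (∀ x ∈ Ioo (0 : ℝ) 1, 0 < f x) ∧
      (∀ x ∈ Icc (0 : ℝ) 1, 0 ≤ f x) ∧ ∫ x in (0 : ℝ)..1, f x ≤ ε := by
  obtain ⟨u, hu, hua, hu0, hu1, huI⟩ := exists_nonneg_germ a ha (ε / 3) (by positivity)
  obtain ⟨v, hv, hvb, hv0, hv1, hvI⟩ := exists_nonneg_germ (fun k => (-1) ^ k * b k)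
    (by
      rcases hb with hb | ⟨j, hj0, hj⟩
      · exact Or.inl fun j => by simp [hb]
      · exact Or.inr ⟨j, fun i hi => by simp [hj0 i hi], hj⟩) (ε / 3) (by positivity)
  set v' : ℝ → ℝ := fun x => v (1 - x) with hv'def
  have hsub : ContDiff ℝ (⊤ : ℕ∞) fun x : ℝ => 1 - x := contDiff_const.sub contDiff_id
  have hv' : ContDiff ℝ (⊤ : ℕ∞) v' := hv.comp hsub
  let φ : ℝ → ℝ := fun x => expNegInvGlue x * expNegInvGlue (1 - x)
  have hφ : ContDiff ℝ (⊤ : ℕ∞) φ := expNegInvGlue.contDiff.mul (expNegInvGlue.contDiff.comp hsub)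
  have hφnn : ∀ x, 0 ≤ φ x := fun x => mul_nonneg (expNegInvGlue.nonneg _) (expNegInvGlue.nonneg _)
  have hφsymm : (fun x => φ (1 - x)) = φ := by
    ext x
    simp only [φ, sub_sub_cancel, mul_comm]
  have hφ0 : ∀ k, iteratedDeriv k φ 0 = 0 := fun k =>
    iteratedDeriv_eq_zero_of_forall_lt φ hφ 0
      (fun x hx => by simp [φ, expNegInvGlue.zero_of_nonpos hx.le]) k
  have hφ1 : ∀ k, iteratedDeriv k φ 1 = 0 := fun k => by
    rw [← hφsymm, iteratedDeriv_comp_const_sub]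
    simp [hφ0]
  set K := ∫ x in (0 : ℝ)..1, φ x with hK
  have hK0 : 0 ≤ K := intervalIntegral.integral_nonneg zero_le_one fun x _ => hφnn x
  set η := ε / 3 / (K + 1) with hη
  have hη0 : 0 < η := by positivity
  have hηK : η * K ≤ ε / 3 := by
    rw [hη, div_mul_eq_mul_div, div_le_iff₀ (by positivity)]
    nlinarith
  have hat : ∀ {g : ℝ → ℝ} {x : ℝ} {k : ℕ}, ContDiff ℝ (⊤ : ℕ∞) g → ContDiffAt ℝ k g x :=
    fun h => (h.of_le (by exact_mod_cast le_top)).contDiffAt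
  have hηφ : ContDiff ℝ (⊤ : ℕ∞) fun x => η * φ x := contDiff_const.mul hφ
  have hder : ∀ k x, iteratedDeriv k (fun x => u x + v' x + η * φ x) x =
      iteratedDeriv k u x + iteratedDeriv k v' x + η * iteratedDeriv k φ x := fun k x => by
    rw [iteratedDeriv_fun_add (hat (hu.add hv')) (hat hηφ), iteratedDeriv_fun_add (hat hu) (hat hv'),
      iteratedDeriv_const_mul_field]
  have hv'nn : ∀ x ∈ Icc (0 : ℝ) 1, 0 ≤ v' x := fun x hx =>
    hv0 _ ⟨by linarith [hx.2], by linarith [hx.1]⟩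
  refine ⟨fun x => u x + v' x + η * φ x, (hu.add hv').add hηφ, fun k => ?_, fun k => ?_,
    fun x hx => ?_, fun x hx => ?_, ?_⟩
  · have : v' =ᶠ[nhds 0] fun _ => 0 := by
      filter_upwards [Iio_mem_nhds (show (0 : ℝ) < 1 / 2 by norm_num)] with x hx
      exact hv1 _ (by linarith [mem_Iio.1 hx])
    rw [hder, hφ0, hua, this.iteratedDeriv_eq]
    simp
  · have : u =ᶠ[nhds 1] fun _ => 0 := by
      filter_upwards [Ioi_mem_nhds (show (1 / 2 : ℝ) < 1 by norm_num)] with x hx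
      exact hu1 _ (mem_Ioi.1 hx).le
    rw [hder, hφ1, this.iteratedDeriv_eq, hv'def, iteratedDeriv_comp_const_sub]
    simp [hvb, ← mul_assoc, ← mul_pow]
  · have h1 : 0 < φ x := mul_pos (expNegInvGlue.pos_of_pos hx.1)
      (expNegInvGlue.pos_of_pos (by linarith [hx.2]))
    have h2 := hu0 x (Ioo_subset_Icc_self hx)
    have h3 := hv'nn x (Ioo_subset_Icc_self hx)
    positivity
  · have h2 := hu0 x hx
    have h3 := hv'nn x hx
    have h1 := hφnn x
    positivity
  · have hi : ∀ {g : ℝ → ℝ}, ContDiff ℝ (⊤ : ℕ∞) g →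
        IntervalIntegrable g MeasureTheory.volume 0 1 := fun h => h.continuous.intervalIntegrable _ _
    rw [intervalIntegral.integral_add (hi (hu.add hv')) (hi hηφ),
      intervalIntegral.integral_add (hi hu) (hi hv'), intervalIntegral.integral_const_mul, ← hK, hv'def,
      intervalIntegral.integral_comp_sub_left v 1]
    norm_num
    linarith

/-- Mollified point masses: their moments up to order three. -/
theorem exists_symmetric_bump (δ : ℝ) (hδ : 0 < δ) :
    ∃ ψ : ℝ → ℝ, ContDiff ℝ (⊤ : ℕ∞) ψ ∧ (∀ x, 0 ≤ ψ x) ∧ (∀ x, δ ≤ |x| → ψ x = 0) ∧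
      ∃ η, 0 ≤ η ∧ η ≤ δ ^ 2 ∧ ∀ y, δ < y → y < 1 - δ →
        ∫ s in (0 : ℝ)..1, ψ (s - y) = 1 ∧
        ∫ s in (0 : ℝ)..1, s * ψ (s - y) = y ∧
        ∫ s in (0 : ℝ)..1, s ^ 2 * ψ (s - y) = y ^ 2 + η ∧
        ∫ s in (0 : ℝ)..1, s ^ 3 * ψ (s - y) = y ^ 3 + 3 * η * y := by
  let χ : ContDiffBump (0 : ℝ) := ⟨δ / 2, δ, by positivity, by linarith⟩
  set ψ : ℝ → ℝ := χ.normed MeasureTheory.volume with hψ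
  have hc : Continuous ψ := χ.continuous_normed
  have hnn : ∀ x, 0 ≤ ψ x := χ.nonneg_normed
  have hz : ∀ x, δ ≤ |x| → ψ x = 0 := fun x hx => by
    have : x ∉ Function.support ψ := by
      rw [hψ, χ.support_normed_eq]
      simpa [χ] using hx
    simpa using this
  have hint : ∀ n : ℕ, MeasureTheory.Integrable fun t => t ^ n * ψ t := fun n =>
    (by fun_prop : Continuous fun t => t ^ n * ψ t).integrable_of_hasCompactSupport
      χ.hasCompactSupport_normed.mul_left
  have hodd : ∀ n : ℕ, Odd n → ∫ t, t ^ n * ψ t = 0 := fun n hn => by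
    have h := MeasureTheory.integral_neg_eq_self (fun t => t ^ n * ψ t) MeasureTheory.volume
    simp only [hn.neg_pow, hψ, χ.normed_neg, neg_mul, MeasureTheory.integral_neg] at h
    simp only [hψ]
    linarith
  have h0 : ∫ t, t ^ 0 * ψ t = 1 := by simpa using χ.integral_normed
  have hη : ∫ t, t ^ 2 * ψ t ≤ δ ^ 2 := by
    calc ∫ t, t ^ 2 * ψ t ≤ ∫ t, δ ^ 2 * (t ^ 0 * ψ t) := by
          refine MeasureTheory.integral_mono (hint 2) ((hint 0).const_mul _) fun t => ?_
          simp only [pow_zero, one_mul]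
          rcases le_or_gt δ |t| with h | h
          · simp [hz t h]
          · exact mul_le_mul_of_nonneg_right (sq_le_sq' (neg_lt_of_abs_lt h).le
              (lt_of_abs_lt h).le) (hnn t)
      _ = δ ^ 2 := by rw [MeasureTheory.integral_const_mul, h0, mul_one]
  refine ⟨ψ, χ.contDiff_normed, hnn, hz, ∫ t, t ^ 2 * ψ t,
    MeasureTheory.integral_nonneg fun t => mul_nonneg (sq_nonneg t) (hnn t), hη, fun y hy hy' => ?_⟩
  have hmom : ∀ n : ℕ, ∫ s in (0 : ℝ)..1, s ^ n * ψ (s - y) = ∫ t, (t + y) ^ n * ψ t := fun n => by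
    rw [intervalIntegral.integral_eq_integral_of_support_subset,
      ← MeasureTheory.integral_sub_right_eq_self (fun t => (t + y) ^ n * ψ t) y]
    · simp
    · intro s hs
      by_contra hs'
      refine hs ?_
      have : ψ (s - y) = 0 := hz _ (by
        rw [mem_Ioc, not_and_or, not_lt, not_le] at hs'
        rcases hs' with h | h
        · exact le_trans (by linarith) (neg_le_abs _)
        · exact le_trans (by linarith) (le_abs_self _))
      simp [this]
  have hcomb : ∀ A B C D : ℝ, ∫ t, (A * (t ^ 0 * ψ t) + B * (t ^ 1 * ψ t) +
      (C * (t ^ 2 * ψ t) + D * (t ^ 3 * ψ t))) = A + C * ∫ t, t ^ 2 * ψ t := fun A B C D => by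
    have h01 : MeasureTheory.Integrable fun t => A * (t ^ 0 * ψ t) + B * (t ^ 1 * ψ t) :=
      ((hint 0).const_mul A).add ((hint 1).const_mul B)
    have h23 : MeasureTheory.Integrable fun t => C * (t ^ 2 * ψ t) + D * (t ^ 3 * ψ t) :=
      ((hint 2).const_mul C).add ((hint 3).const_mul D)
    rw [MeasureTheory.integral_add h01 h23,
      MeasureTheory.integral_add ((hint 0).const_mul A) ((hint 1).const_mul B),
      MeasureTheory.integral_add ((hint 2).const_mul C) ((hint 3).const_mul D)]
    simp only [MeasureTheory.integral_const_mul]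
    rw [hodd 1 (by decide), hodd 3 (by decide), h0]
    ring
  refine ⟨?_, ?_, ?_, ?_⟩
  · have := hmom 0
    simp only [pow_zero, one_mul] at this h0
    rw [this, h0]
  · have := hmom 1
    simp only [pow_one] at this
    rw [this]
    refine Eq.trans ?_ ((hcomb y 1 0 0).trans (by ring))
    congr 1; ext t; ring
  · rw [hmom]
    refine Eq.trans ?_ ((hcomb (y ^ 2) (2 * y) 1 0).trans (by ring))
    congr 1; ext t; ring
  · rw [hmom]
    refine Eq.trans ?_ ((hcomb (y ^ 3) (3 * y ^ 2) (3 * y) 1).trans (by ring))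
    congr 1; ext t; ring

/-- The conditions of `exists_two_atoms` are stable under small perturbations of the data. -/
theorem exists_pos_forall_perturb (m0 m1 m2 m3 : ℝ) (h1 : 0 < m1) (h2 : m1 < m0)
    (h3 : m2 ^ 2 < m1 * m3) (h4 : (m1 - m2) ^ 2 < (m0 - m1) * (m2 - m3)) :
    ∃ ρ > 0, ∀ δ η e0 e1 e2 e3 : ℝ, |δ| < ρ → |η| < ρ → |e0| < ρ → |e1| < ρ → |e2| < ρ →
      |e3| < ρ → ∃ x ∈ Ioo δ (1 - δ), ∃ y ∈ Ioo δ (1 - δ), ∃ w v : ℝ, 0 < w ∧ 0 < v ∧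
        w + v = m0 - e0 ∧ w * x + v * y = m1 - e1 ∧
        w * x ^ 2 + v * y ^ 2 + η * (m0 - e0) = m2 - e2 ∧
        w * x ^ 3 + v * y ^ 3 + 3 * η * (m1 - e1) = m3 - e3 := by
  let n0 : (Fin 6 → ℝ) → ℝ := fun e => m0 - e 2
  let n1 : (Fin 6 → ℝ) → ℝ := fun e => m1 - e 3
  let n2 : (Fin 6 → ℝ) → ℝ := fun e => m2 - e 4 - e 1 * (m0 - e 2)
  let n3 : (Fin 6 → ℝ) → ℝ := fun e => m3 - e 5 - 3 * e 1 * (m1 - e 3)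
  have hev : ∀ᶠ e : Fin 6 → ℝ in nhds 0,
      0 < n1 e - e 0 * n0 e ∧ 0 < (1 - e 0) * n0 e - n1 e ∧ e 0 < 1 - e 0 ∧
      (n2 e - e 0 * n1 e) ^ 2 < (n1 e - e 0 * n0 e) * (n3 e - e 0 * n2 e) ∧
      ((1 - e 0) * n1 e - n2 e) ^ 2 <
        ((1 - e 0) * n0 e - n1 e) * ((1 - e 0) * n2 e - n3 e) := by
    have key : ∀ F G : (Fin 6 → ℝ) → ℝ, Continuous F → Continuous G → F 0 < G 0 →
        ∀ᶠ e in nhds 0, F e < G e := fun F G hF hG h =>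
      hF.continuousAt.eventually_lt hG.continuousAt h
    refine (key _ _ (by fun_prop) (by fun_prop) ?_).and
      ((key _ _ (by fun_prop) (by fun_prop) ?_).and
      ((key _ _ (by fun_prop) (by fun_prop) ?_).and
      ((key _ _ (by fun_prop) (by fun_prop) ?_).and
      (key _ _ (by fun_prop) (by fun_prop) ?_))))
    all_goals simp [n0, n1, n2, n3, h1, h2, h3, h4]
  obtain ⟨ρ, hρ, H⟩ := Metric.eventually_nhds_iff.1 hev
  refine ⟨ρ, hρ, fun δ η e0 e1 e2 e3 hδ hη he0 he1 he2 he3 => ?_⟩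
  obtain ⟨c1, c2, c3, c4, c5⟩ := H (y := ![δ, η, e0, e1, e2, e3]) (by
    rw [dist_zero_right, pi_norm_lt_iff hρ]
    intro i
    fin_cases i <;> assumption)
  obtain ⟨x, hx, y, hy, w, v, hw, hv, E0, E1, E2, E3⟩ :=
    exists_two_atoms _ _ _ _ _ _ c1 c2 c3 c4 c5
  simp [n0, n1, n2, n3] at hx hy E0 E1 E2 E3
  exact ⟨x, hx, y, hy, w, v, hw, hv, E0, E1, by linarith, by linarith⟩

/-- A smooth positive density on `(0, 1)` with prescribed derivatives at the endpoints and
prescribed first four moments. -/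
theorem exists_pos_of_jets_of_moments (m0 m1 m2 m3 : ℝ) (h1 : 0 < m1) (h2 : m1 < m0)
    (h3 : m2 ^ 2 < m1 * m3) (h4 : (m1 - m2) ^ 2 < (m0 - m1) * (m2 - m3)) (a b : ℕ → ℝ)
    (ha : (∀ j, a j = 0) ∨ ∃ j, (∀ i < j, a i = 0) ∧ 0 < a j)
    (hb : (∀ j, b j = 0) ∨ ∃ j, (∀ i < j, b i = 0) ∧ 0 < (-1) ^ j * b j) :
    ∃ f : ℝ → ℝ, ContDiff ℝ (⊤ : ℕ∞) f ∧ (∀ k, iteratedDeriv k f 0 = a k) ∧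
      (∀ k, iteratedDeriv k f 1 = b k) ∧ (∀ x ∈ Ioo (0 : ℝ) 1, 0 < f x) ∧
      ∫ t in (0 : ℝ)..1, f t = m0 ∧ ∫ t in (0 : ℝ)..1, (1 - t) * f t = m1 ∧
      ∫ t in (0 : ℝ)..1, (1 - t) ^ 2 * f t = m2 ∧ ∫ t in (0 : ℝ)..1, (1 - t) ^ 3 * f t = m3 := by
  obtain ⟨ρ, hρ, H⟩ := exists_pos_forall_perturb m0 m1 m2 m3 h1 h2 h3 h4
  obtain ⟨f, hf, hfa, hfb, hfpos, hfnn, hfI⟩ := exists_pos_of_jets a b ha hb (ρ / 2) (by positivity)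
  set δ := min ρ 1 / 2 with hδ
  have hδ0 : 0 < δ := by positivity
  have hδρ : δ < ρ := by linarith [min_le_left ρ 1]
  have hδ1 : δ < 1 := by linarith [min_le_right ρ 1]
  obtain ⟨ψ, hψ, hψnn, hψz, η, hη0, hηδ, hmom⟩ := exists_symmetric_bump δ hδ0
  have hmoment : ∀ n : ℕ, |∫ t in (0 : ℝ)..1, (1 - t) ^ n * f t| < ρ := fun n => by
    have hle : ∫ t in (0 : ℝ)..1, (1 - t) ^ n * f t ≤ ∫ t in (0 : ℝ)..1, f t := by
      have hc : Continuous fun t => (1 - t) ^ n * f t :=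
        ((continuous_const.sub continuous_id).pow n).mul hf.continuous
      refine intervalIntegral.integral_mono_on zero_le_one (hc.intervalIntegrable _ _)
        (hf.continuous.intervalIntegrable _ _) fun t ht => ?_
      exact mul_le_of_le_one_left (hfnn t ht)
        (pow_le_one₀ (by linarith [ht.2]) (by linarith [ht.1]))
    have hnn : 0 ≤ ∫ t in (0 : ℝ)..1, (1 - t) ^ n * f t :=
      intervalIntegral.integral_nonneg zero_le_one fun t ht =>
        mul_nonneg (pow_nonneg (by linarith [ht.2]) n) (hfnn t ht)
    rw [abs_of_nonneg hnn]
    linarith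
  obtain ⟨x, hx, y, hy, w, v, hw, hv, E0, E1, E2, E3⟩ := H δ η _ _ _ _
    (by rwa [abs_of_pos hδ0]) (by rw [abs_of_nonneg hη0]; nlinarith)
    (hmoment 0) (hmoment 1) (hmoment 2) (hmoment 3)
  have hatom : ∀ z, ContDiff ℝ (⊤ : ℕ∞) fun t : ℝ => ψ (1 - t - z) := fun z =>
    hψ.comp ((contDiff_const.sub contDiff_id).sub contDiff_const)
  have hg : ContDiff ℝ (⊤ : ℕ∞) fun t => f t + (w * ψ (1 - t - x) + v * ψ (1 - t - y)) :=
    hf.add ((contDiff_const.mul (hatom x)).add (contDiff_const.mul (hatom y)))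
  have hz0 : ∀ z ∈ Ioo δ (1 - δ), ∀ᶠ t in nhds (0 : ℝ), ψ (1 - t - z) = 0 := fun z hz => by
    filter_upwards [Iio_mem_nhds (show (0 : ℝ) < 1 - δ - z by linarith [hz.2])] with t ht
    exact hψz _ (le_trans (by linarith [mem_Iio.1 ht]) (le_abs_self _))
  have hz1 : ∀ z ∈ Ioo δ (1 - δ), ∀ᶠ t in nhds (1 : ℝ), ψ (1 - t - z) = 0 := fun z hz => by
    filter_upwards [Ioi_mem_nhds (show (1 + δ - z : ℝ) < 1 by linarith [hz.1])] with t ht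
    exact hψz _ (le_trans (by linarith [mem_Ioi.1 ht]) (neg_le_abs _))
  have hsplit : ∀ n : ℕ, ∫ t in (0 : ℝ)..1,
      (1 - t) ^ n * (f t + (w * ψ (1 - t - x) + v * ψ (1 - t - y))) =
      (∫ t in (0 : ℝ)..1, (1 - t) ^ n * f t) + (w * (∫ s in (0 : ℝ)..1, s ^ n * ψ (s - x)) +
        v * ∫ s in (0 : ℝ)..1, s ^ n * ψ (s - y)) := fun n => by
    have hp : Continuous fun t : ℝ => (1 - t) ^ n := by fun_prop
    have hi : ∀ {g : ℝ → ℝ}, Continuous g → IntervalIntegrable g MeasureTheory.volume 0 1 :=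
      fun h => h.intervalIntegrable _ _
    have hcz : ∀ c z, Continuous fun t => c * ((1 - t) ^ n * ψ (1 - t - z)) := fun c z =>
      continuous_const.mul (hp.mul (hatom z).continuous)
    have hpf : Continuous fun t => (1 - t) ^ n * f t := hp.mul hf.continuous
    have hcs : Continuous fun t => w * ((1 - t) ^ n * ψ (1 - t - x)) +
        v * ((1 - t) ^ n * ψ (1 - t - y)) := (hcz w x).add (hcz v y)
    have hrefl : ∀ z, ∫ t in (0 : ℝ)..1, (1 - t) ^ n * ψ (1 - t - z) =
        ∫ s in (0 : ℝ)..1, s ^ n * ψ (s - z) := fun z => by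
      rw [intervalIntegral.integral_comp_sub_left (fun s => s ^ n * ψ (s - z)) 1]
      norm_num
    rw [← hrefl x, ← hrefl y, ← intervalIntegral.integral_const_mul,
      ← intervalIntegral.integral_const_mul,
      ← intervalIntegral.integral_add (hi (hcz w x)) (hi (hcz v y)),
      ← intervalIntegral.integral_add (hi hpf) (hi hcs)]
    congr 1
    ext t
    ring
  obtain ⟨x0, x1, x2, x3⟩ := hmom x hx.1 hx.2
  obtain ⟨y0, y1, y2, y3⟩ := hmom y hy.1 hy.2
  refine ⟨_, hg, fun k => ?_, fun k => ?_, fun t ht => ?_, ?_, ?_, ?_, ?_⟩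
  · rw [← hfa k]
    refine Filter.EventuallyEq.iteratedDeriv_eq k ?_
    filter_upwards [hz0 x hx, hz0 y hy] with t h h'
    simp [h, h']
  · rw [← hfb k]
    refine Filter.EventuallyEq.iteratedDeriv_eq k ?_
    filter_upwards [hz1 x hx, hz1 y hy] with t h h'
    simp [h, h']
  · have := hfpos t ht
    have := mul_nonneg hw.le (hψnn (1 - t - x))
    have := mul_nonneg hv.le (hψnn (1 - t - y))
    linarith
  · have := hsplit 0
    simp only [pow_zero, one_mul] at this E0
    rw [this, x0, y0]
    linarith
  · have := hsplit 1
    simp only [pow_one] at this E1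
    rw [this, x1, y1]
    linarith
  · rw [hsplit, x2, y2]
    linear_combination E2 + η * E0
  · rw [hsplit, x3, y3]
    linear_combination E3 + 3 * η * E1

/-- One step of Cauchy's formula for repeated integration. -/
theorem integral_pow_mul_I {g : ℝ → ℝ} (hg : Continuous g) (n : ℕ) :
    (n + 1) * ∫ t in (0 : ℝ)..1, (1 - t) ^ n * I g t = ∫ t in (0 : ℝ)..1, (1 - t) ^ (n + 1) * g t := by
  have hpow : ∀ t : ℝ, HasDerivAt (fun t : ℝ => (1 - t) ^ (n + 1)) (-((n + 1) * (1 - t) ^ n)) t :=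
    fun t => by
      have := ((hasDerivAt_id' t).const_sub 1).fun_pow (n + 1)
      simpa using this
  have hc : Continuous fun t : ℝ => -(((n : ℝ) + 1) * (1 - t) ^ n) := by fun_prop
  have := intervalIntegral.integral_mul_deriv_eq_deriv_mul (a := 0) (b := 1)
    (fun t _ => hpow t) (fun t _ => hasDerivAt_I hg t) (hc.intervalIntegrable _ _)
    (hg.intervalIntegrable _ _)
  rw [this, ← intervalIntegral.integral_const_mul]
  simp [I, mul_assoc]

theorem stmt6 (a b c d : ℝ)
    (h1 : 0 < c) (h2 : c < d)
    (h3 : 2 * b ^ 2 < 3 * a * c)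
    (h4 : 6 * a * d + c ^ 2 + 4 * b ^ 2 < 6 * a * c + 2 * b * c + 2 * b * d)
    (α β : ℕ → ℝ)
    (hα : (∀ j, 1 ≤ j → α j = 0) ∨
      (∃ j, 1 ≤ j ∧ (∀ i, 1 ≤ i → i < j → α i = 0) ∧ 0 < α j))
    (hβ : (∀ j, 1 ≤ j → β j = 0) ∨
      (∃ j, 1 ≤ j ∧ (∀ i, 1 ≤ i → i < j → β i = 0) ∧ 0 < (-1 : ℝ) ^ (j + 1) * β j)) :
    ∃ g : ℝ → ℝ, ContDiff ℝ (⊤ : ℕ∞) g ∧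
      (∀ x ∈ Ioo (0:ℝ) 1, 0 < deriv g x) ∧
      g 0 = 0 ∧ g 1 = d ∧
      I g 1 = c ∧ I (I g) 1 = b ∧ I (I (I g)) 1 = a ∧
      (∀ j, 1 ≤ j → iteratedDeriv j g 0 = α j ∧ iteratedDeriv j g 1 = β j) := by
  obtain ⟨f, hf, hf0, hf1, hfpos, M0, M1, M2, M3⟩ :=
    exists_pos_of_jets_of_moments d c (2 * b) (6 * a) h1 h2 (by nlinarith) (by nlinarith)
      (fun k => α (k + 1)) (fun k => β (k + 1))
      (by
        rcases hα with h | ⟨j, hj, h, h'⟩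
        · exact Or.inl fun j => h _ (by omega)
        · obtain ⟨j, rfl⟩ := Nat.exists_eq_add_of_le' hj
          exact Or.inr ⟨j, fun i hi => h _ (by omega) (by omega), h'⟩)
      (by
        rcases hβ with h | ⟨j, hj, h, h'⟩
        · exact Or.inl fun j => h _ (by omega)
        · obtain ⟨j, rfl⟩ := Nat.exists_eq_add_of_le' hj
          refine Or.inr ⟨j, fun i hi => h _ (by omega) (by omega), ?_⟩
          simpa [pow_succ] using h')
  have hc := hf.continuous
  have hc1 := continuous_I hc
  have hc2 := continuous_I hc1
  have hderiv : deriv (I f) = f := funext fun x => (hasDerivAt_I hc x).deriv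
  have hI : ∀ g, I g 1 = ∫ t in (0 : ℝ)..1, (1 - t) ^ 0 * g t := fun g => by simp [I]
  have s1 : ∀ {g}, Continuous g → I (I g) 1 = ∫ t in (0 : ℝ)..1, (1 - t) * g t := fun hg => by
    have := integral_pow_mul_I hg 0
    rw [hI]
    simpa using this
  have s2 : ∀ {g}, Continuous g → 2 * I (I (I g)) 1 = ∫ t in (0 : ℝ)..1, (1 - t) ^ 2 * g t :=
    fun hg => by
      have := integral_pow_mul_I hg 1
      rw [s1 (continuous_I hg)]
      norm_num at this
      exact this
  refine ⟨I f, contDiff_infty_iff_deriv.2 ⟨fun x => (hasDerivAt_I hc x).differentiableAt,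
    by rwa [hderiv]⟩, by rwa [hderiv], by simp [I], M0, ?_, ?_, ?_, fun j hj => ?_⟩
  · rw [s1 hc, M1]
  · linarith [s2 hc]
  · have h := integral_pow_mul_I hc 2
    have h' := s2 hc1
    norm_num at h
    linarith
  · obtain ⟨j, rfl⟩ := Nat.exists_eq_add_of_le' hj
    rw [iteratedDeriv_succ', hderiv]
    exact ⟨hf0 j, hf1 j⟩
end
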